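/- arXiv:2002.01853 — 8 statements merged into one kernel-verified Lean document; each statement's English description precedes it below -/
import Mathlib

section
/- Suppose e/d is even and write e = 2m. Let a ∈ F_q^* be a (2^d+1)-th power in F_q^* (i.e., a = c^{2^d+1} for some c ∈ F_q^*), let b ∈ F_q^*, and define f(x) = a^{2^α}·x^{2^{2α}} + a·x. If x₀ ∈ F_q satisfies f(x₀) = b^{2^α}, then S_α(a,b) = −(−1)^{m/d}·2^{m+d}·χ₁(a·x₀^{2^α+1}). -/
section PowerCounts

variable {F : Type} [Field F] [Fintype F] [DecidableEq F]

lemma card_units_pow_eq_one (n : ℕ) :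
    (Finset.univ.filter fun u : Fˣ => u ^ n = 1).card = (Fintype.card F - 1).gcd n := by
  have h := IsCyclic.card_powMonoidHom_ker (G := Fˣ) n
  rw [Nat.card_eq_fintype_card (α := Fˣ), Fintype.card_units] at h
  rw [← h, Nat.card_eq_fintype_card, ← Fintype.card_subtype]
  exact Fintype.card_congr (Equiv.subtypeEquivRight fun u => by simp [MonoidHom.mem_ker])

lemma gcd_dvd_sum_units_pow (n : ℕ) (f : Fˣ → ℤ) :
    (((Fintype.card F - 1).gcd n : ℕ) : ℤ) ∣ ∑ u : Fˣ, f (u ^ n) := by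
  rw [← Finset.sum_fiberwise Finset.univ (fun u : Fˣ => u ^ n)]
  refine Finset.dvd_sum fun v _ => ?_
  rw [Finset.sum_congr rfl (g := fun _ => f v) (by simp +contextual), Finset.sum_const,
    nsmul_eq_mul]
  refine Dvd.dvd.mul_right ?_ _
  by_cases hv : v ∈ Set.range (powMonoidHom n : Fˣ →* Fˣ)
  · have h := MonoidHom.card_fiber_eq_of_mem_range (powMonoidHom n : Fˣ →* Fˣ) hv
      (⟨1, by simp⟩ : (1 : Fˣ) ∈ Set.range (powMonoidHom n : Fˣ →* Fˣ))
    simp only [powMonoidHom_apply] at h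
    rw [h, card_units_pow_eq_one]
  · rw [Finset.filter_false_of_mem (by
      intro u _ hu
      exact hv ⟨u, by simpa using hu⟩)]
    simp

lemma sum_eq_zero_add_sum_units (g : F → ℤ) : ∑ x, g x = g 0 + ∑ u : Fˣ, g u := by
  rw [← Finset.add_sum_erase _ _ (Finset.mem_univ (0 : F))]
  congr 1
  refine (Finset.sum_bij (fun (u : Fˣ) _ => (u : F)) (by simp) (fun _ _ _ _ h => Units.ext h)
    ?_ (fun _ _ => rfl)).symm
  intro x hx
  exact ⟨Units.mk0 x (by simpa using hx), by simp, rfl⟩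

lemma card_pow_succ_eq_self (n : ℕ) :
    (Finset.univ.filter fun x : F => x ^ (n + 1) = x).card = (Fintype.card F - 1).gcd n + 1 := by
  have h := sum_eq_zero_add_sum_units (fun x : F => if x ^ (n + 1) = x then (1 : ℤ) else 0)
  rw [Finset.sum_boole] at h
  have h2 : ∀ u : Fˣ, ((u : F) ^ (n + 1) = u) ↔ u ^ n = 1 := fun u => by
    rw [pow_succ, mul_eq_right₀ u.ne_zero, ← Units.val_pow_eq_pow_val, Units.val_eq_one]
  simp only [h2, Finset.sum_boole, card_units_pow_eq_one] at h
  simp at h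
  exact_mod_cast h.trans (add_comm _ _)

end PowerCounts

section BinaryCharacter

variable {F : Type} [Field F] [DecidableEq F]

/-- The canonical additive character of the field with `2 ^ e` elements. -/
def binaryChar (e : ℕ) (x : F) : ℤ :=
  if ∑ i ∈ Finset.range e, x ^ 2 ^ i = 0 then 1 else -1

lemma binaryChar_zero (e : ℕ) : binaryChar e (0 : F) = 1 := by
  simp [binaryChar]

lemma binaryChar_mul_self (e : ℕ) (x : F) : binaryChar e x * binaryChar e x = 1 := by
  unfold binaryChar; split_ifs <;> rfl

variable [Fintype F] {e : ℕ}

omit [DecidableEq F] in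
lemma sum_range_pow_two_pow_sq (hF : Fintype.card F = 2 ^ e) (x : F) :
    ∑ i ∈ Finset.range e, (x ^ 2) ^ 2 ^ i = ∑ i ∈ Finset.range e, x ^ 2 ^ i := by
  have h : ∀ i, (x ^ 2) ^ 2 ^ i = x ^ 2 ^ (i + 1) := fun i => by rw [← pow_mul, pow_succ']
  simp only [h]
  have h1 := Finset.sum_range_succ (fun i => x ^ 2 ^ i) e
  rw [Finset.sum_range_succ', ← hF, FiniteField.pow_card, pow_zero, pow_one] at h1
  exact add_right_cancel h1

lemma binaryChar_pow_two_pow (hF : Fintype.card F = 2 ^ e) (n : ℕ) (x : F) :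
    binaryChar e (x ^ 2 ^ n) = binaryChar e x := by
  induction n with
  | zero => simp
  | succ n ih =>
    rw [← ih, pow_succ, pow_mul, binaryChar, sum_range_pow_two_pow_sq hF, binaryChar]

variable [CharP F 2]

omit [DecidableEq F] in
lemma sum_range_pow_two_pow_eq_zero_or_one (hF : Fintype.card F = 2 ^ e) (x : F) :
    ∑ i ∈ Finset.range e, x ^ 2 ^ i = 0 ∨ ∑ i ∈ Finset.range e, x ^ 2 ^ i = 1 := by
  have h : (∑ i ∈ Finset.range e, x ^ 2 ^ i) ^ 2 = ∑ i ∈ Finset.range e, x ^ 2 ^ i := by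
    conv_rhs => rw [← sum_range_pow_two_pow_sq hF]
    rw [sum_pow_char 2]
    exact Finset.sum_congr rfl fun i _ => pow_right_comm _ _ _
  have h0 : (∑ i ∈ Finset.range e, x ^ 2 ^ i) * (∑ i ∈ Finset.range e, x ^ 2 ^ i - 1) = 0 := by
    linear_combination h
  exact (mul_eq_zero.1 h0).imp_right sub_eq_zero.1

lemma binaryChar_add (hF : Fintype.card F = 2 ^ e) (x y : F) :
    binaryChar e (x + y) = binaryChar e x * binaryChar e y := by
  unfold binaryChar
  simp only [add_pow_char_pow, Finset.sum_add_distrib]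
  rcases sum_range_pow_two_pow_eq_zero_or_one hF x with h | h <;>
    rcases sum_range_pow_two_pow_eq_zero_or_one hF y with h' | h' <;>
    simp [h, h', CharTwo.add_self_eq_zero]

omit [CharP F 2] in
lemma exists_binaryChar_eq_neg_one (he : 0 < e) (hF : Fintype.card F = 2 ^ e) :
    ∃ x : F, binaryChar e x = -1 := by
  by_contra! h
  let p : Polynomial F := ∑ i ∈ Finset.range e, Polynomial.X ^ 2 ^ i
  have hp : p ≠ 0 := by
    intro h0
    have h1 : p.coeff 1 = 0 := by rw [h0, Polynomial.coeff_zero]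
    rw [Polynomial.finsetSum_coeff, Finset.sum_eq_single 0] at h1
    · simp at h1
    · intro i _ hi
      rw [Polynomial.coeff_X_pow, if_neg]
      exact (Nat.one_lt_two_pow hi).ne
    · simp [he]
  have hdeg : p.natDegree ≤ 2 ^ (e - 1) := by
    refine Polynomial.natDegree_sum_le_of_forall_le _ _ fun i hi => ?_
    rw [Polynomial.natDegree_X_pow]
    exact Nat.pow_le_pow_right two_pos (by have := Finset.mem_range.1 hi; omega)
  have hroot : ∀ x : F, p.eval x = 0 := fun x => by
    have hx := h x
    simp only [binaryChar, ne_eq, ite_eq_right_iff, not_forall] at hx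
    by_contra hne
    simp [p, Polynomial.eval_finsetSum] at hne
    simp_all
  refine hp (Polynomial.eq_zero_of_natDegree_lt_card_of_eval_eq_zero p
    Function.injective_id hroot (hdeg.trans_lt ?_))
  rw [hF]
  exact Nat.pow_lt_pow_right one_lt_two (by omega)

lemma sum_binaryChar_mul (he : 0 < e) (hF : Fintype.card F = 2 ^ e) (c : F) :
    ∑ y : F, binaryChar e (c * y) = if c = 0 then 2 ^ e else 0 := by
  split_ifs with hc
  · simp [hc, binaryChar_zero, hF]
  · obtain ⟨z, hz⟩ := exists_binaryChar_eq_neg_one he hF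
    have h := Equiv.sum_comp (Equiv.addRight (z / c)) fun y => binaryChar e (c * y)
    simp only [Equiv.coe_addRight, mul_add, mul_div_cancel₀ z hc, binaryChar_add hF, hz,
      ← Finset.sum_mul] at h
    linarith

/-- The polar form of `x ↦ χ (x ^ (2 ^ α + 1))` in adjoint form. -/
lemma binaryChar_add_pow (hF : Fintype.card F = 2 ^ e) (α : ℕ) (x y : F) :
    binaryChar e ((x + y) ^ (2 ^ α + 1)) * binaryChar e (y ^ (2 ^ α + 1)) =
      binaryChar e (x ^ (2 ^ α + 1)) *
        binaryChar e ((x ^ 2 ^ (2 * α) + x) * y ^ 2 ^ α) := by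
  have h1 : (x + y) ^ (2 ^ α + 1) =
      x ^ (2 ^ α + 1) + (x ^ 2 ^ α * y + x * y ^ 2 ^ α) + y ^ (2 ^ α + 1) := by
    rw [pow_succ, add_pow_char_pow]; ring
  have h2 : (x ^ 2 ^ α * y) ^ 2 ^ α = x ^ 2 ^ (2 * α) * y ^ 2 ^ α := by
    rw [mul_pow, ← pow_mul, ← pow_add, two_mul]
  rw [h1, binaryChar_add hF _ (y ^ _), mul_assoc, binaryChar_mul_self, mul_one,
    binaryChar_add hF, binaryChar_add hF, add_mul, binaryChar_add hF, ← h2,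
    binaryChar_pow_two_pow hF]

lemma sum_binaryChar_pow_sq (he : 0 < e) (hF : Fintype.card F = 2 ^ e) (α : ℕ) :
    (∑ x : F, binaryChar e (x ^ (2 ^ α + 1))) ^ 2 =
      2 ^ e * ∑ x ∈ Finset.univ.filter (fun x : F => x ^ 2 ^ (2 * α) = x),
        binaryChar e (x ^ (2 ^ α + 1)) := by
  have hbij : Function.Bijective fun y : F => y ^ 2 ^ α := by
    have := Finite.injective_iff_bijective.1 (iterateFrobenius F 2 α).injective
    exact this
  have hinner : ∀ x : F, ∑ y : F, binaryChar e ((x ^ 2 ^ (2 * α) + x) * y ^ 2 ^ α) =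
      if x ^ 2 ^ (2 * α) = x then 2 ^ e else 0 := fun x => by
    rw [hbij.sum_comp fun y => binaryChar e ((x ^ 2 ^ (2 * α) + x) * y),
      sum_binaryChar_mul he hF]
    simp only [CharTwo.add_eq_zero]
  calc _ = ∑ y : F, ∑ x : F,
        binaryChar e ((x + y) ^ (2 ^ α + 1)) * binaryChar e (y ^ (2 ^ α + 1)) := by
        rw [pow_two, Finset.mul_sum]
        refine Finset.sum_congr rfl fun y _ => ?_
        rw [← Finset.sum_mul, ← Equiv.sum_comp (Equiv.addRight y)]
        rfl
    _ = _ := by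
        rw [Finset.sum_comm, Finset.mul_sum, Finset.sum_filter]
        refine Finset.sum_congr rfl fun x _ => ?_
        simp only [binaryChar_add_pow hF]
        rw [← Finset.mul_sum, hinner]
        split_ifs <;> ring

omit [Fintype F] in
lemma binaryChar_eq_one_of_pow_two_pow_eq_self {m : ℕ} (hm : e = 2 * m) {y : F}
    (hy : y ^ 2 ^ m = y) : binaryChar e y = 1 := by
  have h : ∑ i ∈ Finset.range e, y ^ 2 ^ i = 0 := by
    rw [hm, two_mul, Finset.sum_range_add]
    simp only [pow_add 2 m, pow_mul y, hy]
    exact CharTwo.add_self_eq_zero _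
  simp [binaryChar, h]

lemma binaryChar_shift (hF : Fintype.card F = 2 ^ e) (α : ℕ) {a b x₀ : F}
    (hx₀ : a ^ 2 ^ α * x₀ ^ 2 ^ (2 * α) + a * x₀ = b ^ 2 ^ α) (x : F) :
    binaryChar e (a * (x + x₀) ^ (2 ^ α + 1) + b * (x + x₀)) =
      binaryChar e (a * x ^ (2 ^ α + 1)) * binaryChar e (a * x₀ ^ (2 ^ α + 1)) := by
  have hlin : ∀ z : F, binaryChar e (b * z) =
      binaryChar e (a * x₀ ^ 2 ^ α * z) * binaryChar e (a * x₀ * z ^ 2 ^ α) := fun z => by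
    rw [← binaryChar_pow_two_pow hF α (b * z), ← binaryChar_pow_two_pow hF α (_ * z),
      ← binaryChar_add hF, mul_pow b, ← hx₀, two_mul, pow_add 2 α α, pow_mul]
    congr 1
    ring
  have h1 : a * (x + x₀) ^ (2 ^ α + 1) = a * x ^ (2 ^ α + 1) +
      (a * x₀ ^ 2 ^ α * x + a * x₀ * x ^ 2 ^ α) + a * x₀ ^ (2 ^ α + 1) := by
    rw [pow_succ, add_pow_char_pow]; ring
  have h2 : binaryChar e (b * x₀) = 1 := by
    rw [hlin, show a * x₀ * x₀ ^ 2 ^ α = a * x₀ ^ 2 ^ α * x₀ by ring, binaryChar_mul_self]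
  rw [binaryChar_add hF, mul_add b, binaryChar_add hF (b * x), h2, h1, binaryChar_add hF,
    binaryChar_add hF, binaryChar_add hF, ← hlin]
  linear_combination binaryChar e (a * x ^ (2 ^ α + 1)) *
    binaryChar e (a * x₀ ^ (2 ^ α + 1)) * binaryChar_mul_self e (b * x)

end BinaryCharacter

section Arithmetic

lemma two_pow_add_one_dvd_of_odd (d : ℕ) {j : ℕ} (hj : Odd j) :
    2 ^ d + 1 ∣ 2 ^ (d * j) + 1 := by
  have := hj.nat_add_dvd_pow_add_pow (2 ^ d) 1
  rwa [one_pow, ← pow_mul] at this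

lemma two_pow_add_one_dvd_two_pow_sub_one (d k : ℕ) :
    2 ^ d + 1 ∣ 2 ^ (d * (2 * k)) - 1 := by
  have h1 : 2 ^ d + 1 ∣ 2 ^ (d * 2) - 1 := by
    rw [pow_mul]
    exact ⟨2 ^ d - 1, by simpa using Nat.sq_sub_sq (2 ^ d) 1⟩
  refine h1.trans ?_
  rw [← mul_assoc, pow_mul 2 (d * 2)]
  simpa using Nat.sub_dvd_pow_sub_pow (2 ^ (d * 2)) 1 k

lemma gcd_two_pow_sub_one_two_pow_add_one {d j k : ℕ} (hjk : j.Coprime (2 * k)) :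
    (2 ^ (d * (2 * k)) - 1).gcd (2 ^ (d * j) + 1) = 2 ^ d + 1 := by
  have hj : Odd j := (Nat.coprime_two_right).1 (hjk.coprime_dvd_right ⟨k, rfl⟩)
  refine Nat.dvd_antisymm ?_ (Nat.dvd_gcd (two_pow_add_one_dvd_two_pow_sub_one d k)
    (two_pow_add_one_dvd_of_odd d hj))
  set g := (2 ^ (d * (2 * k)) - 1).gcd (2 ^ (d * j) + 1) with hg
  have h1 : g ∣ 2 ^ (d * (2 * k)) - 1 := Nat.gcd_dvd_left _ _
  have h2 : g ∣ 2 ^ (d * j) + 1 := Nat.gcd_dvd_right _ _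
  have h3 : g ∣ 2 ^ (d * (2 * j)) - 1 := by
    refine h2.trans ⟨2 ^ (d * j) - 1, ?_⟩
    rw [show d * (2 * j) = d * j * 2 by ring, pow_mul]
    simpa using Nat.sq_sub_sq (2 ^ (d * j)) 1
  have h4 : g ∣ 2 ^ (d * 2) - 1 := by
    have := Nat.dvd_gcd h1 h3
    rwa [Nat.pow_sub_one_gcd_pow_sub_one, Nat.gcd_mul_left, Nat.gcd_mul_left,
      (hjk.coprime_dvd_right ⟨2, by ring⟩).symm.gcd_eq_one, mul_one] at this
  have h5 : (2 : ZMod g) ^ (d * 2) = 1 := by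
    have h := (ZMod.natCast_eq_zero_iff _ _).2 h4
    rw [Nat.cast_sub Nat.one_le_two_pow] at h
    push_cast at h
    exact sub_eq_zero.1 h
  have h6 := (ZMod.natCast_eq_zero_iff _ _).2 h2
  obtain ⟨i, rfl⟩ := hj
  rw [← ZMod.natCast_eq_zero_iff]
  push_cast at h6 ⊢
  rwa [show d * (2 * i + 1) = d * 2 * i + d by ring, pow_add, pow_mul, h5, one_pow,
    one_mul] at h6

lemma eq_of_sq_eq_of_dvd {d k : ℕ} (hd : 0 < d) {T : ℤ} (hT : T ^ 2 = (2 ^ (d * k + d)) ^ 2)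
    (hdvd : (2 ^ d + 1 : ℤ) ∣ T - 1) : T = -(-1) ^ k * 2 ^ (d * k + d) := by
  have hpow : (2 ^ d + 1 : ℤ) ∣ 2 ^ (d * k + d) - (-1) ^ (k + 1) := by
    have := sub_dvd_pow_sub_pow (2 ^ d : ℤ) (-1) (k + 1)
    rwa [sub_neg_eq_add, ← pow_mul, mul_add_one] at this
  have h2 : ¬ (2 ^ d + 1 : ℤ) ∣ 2 := fun h => by
    have h3 := Int.le_of_dvd two_pos h
    have h4 : (2 : ℤ) ^ 1 ≤ 2 ^ d := pow_le_pow_right₀ one_le_two hd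
    linarith
  rcases neg_one_pow_eq_or ℤ k with hk | hk <;>
    rcases sq_eq_sq_iff_eq_or_eq_neg.1 hT with h | h <;>
    rw [pow_succ, hk] at hpow <;> rw [hk]
  · have h3 := dvd_sub hpow hdvd
    rw [h, show ∀ P : ℤ, P - 1 * -1 - (P - 1) = 2 from fun P => by ring] at h3
    exact absurd h3 h2
  · rw [h]; ring
  · rw [h]; ring
  · have h3 := dvd_neg.2 (dvd_add hpow hdvd)
    rw [h, show ∀ P : ℤ, -(P - -1 * -1 + (-P - 1)) = 2 from fun P => by ring] at h3
    exact absurd h3 h2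

end Arithmetic

section GoldSum

variable {F : Type} [Field F] [Fintype F] [DecidableEq F]

omit [DecidableEq F] in
lemma exists_pow_eq_of_gcd {c : F} (hc : c ≠ 0) (n : ℕ) :
    ∃ u : F, u ≠ 0 ∧ c ^ (Fintype.card F - 1).gcd n = u ^ n := by
  set N := Fintype.card F - 1
  refine ⟨c ^ N.gcdB n, zpow_ne_zero _ hc, ?_⟩
  rw [← zpow_natCast c, Nat.gcd_eq_gcd_ab, zpow_add₀ hc, zpow_mul, zpow_natCast c N,
    FiniteField.pow_card_sub_one_eq_one c hc, one_zpow, one_mul, mul_comm, zpow_mul,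
    zpow_natCast]

lemma sum_binaryChar_pow [CharP F 2] {d j k : ℕ} (hd : 0 < d) (hk : 0 < k)
    (hjk : j.Coprime (2 * k)) (hF : Fintype.card F = 2 ^ (d * (2 * k))) :
    ∑ x : F, binaryChar (d * (2 * k)) (x ^ (2 ^ (d * j) + 1)) =
      -(-1) ^ k * 2 ^ (d * k + d) := by
  have he : 0 < d * (2 * k) := by positivity
  have hj : Odd j := (Nat.coprime_two_right).1 (hjk.coprime_dvd_right ⟨k, rfl⟩)
  refine eq_of_sq_eq_of_dvd hd ?_ ?_
  · have hgcd : (Fintype.card F - 1).gcd (2 ^ (2 * (d * j)) - 1) = 2 ^ (2 * d) - 1 := by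
      rw [hF, Nat.pow_sub_one_gcd_pow_sub_one, show 2 * (d * j) = d * (2 * j) by ring,
        Nat.gcd_mul_left, Nat.gcd_mul_left,
        (hjk.coprime_dvd_right ⟨2, by ring⟩).symm.gcd_eq_one, mul_one, mul_comm]
    have hcard := card_pow_succ_eq_self (F := F) (2 ^ (2 * (d * j)) - 1)
    rw [hgcd, Nat.sub_add_cancel Nat.one_le_two_pow, Nat.sub_add_cancel Nat.one_le_two_pow]
      at hcard
    rw [sum_binaryChar_pow_sq he hF, Finset.sum_congr rfl (g := fun _ => (1 : ℤ)),
      Finset.sum_const, hcard]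
    · simp only [nsmul_eq_mul, mul_one]
      push_cast
      ring
    · intro x hx
      have hx : x ^ 2 ^ (2 * (d * j)) = x := (Finset.mem_filter.1 hx).2
      have hx2 : x ^ 2 ^ (d * 2) = x := by
        rcases eq_or_ne x 0 with rfl | h0
        · simp
        have h1 : x ^ (2 ^ (2 * (d * j)) - 1) = 1 := by
          rw [← mul_eq_right₀ h0, ← pow_succ, Nat.sub_add_cancel Nat.one_le_two_pow, hx]
        have h2 := pow_gcd_eq_one.2 ⟨FiniteField.pow_card_sub_one_eq_one x h0, h1⟩
        rw [hgcd] at h2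
        rw [mul_comm, ← Nat.sub_add_cancel (n := 2 ^ (2 * d)) (m := 1) Nat.one_le_two_pow,
          pow_succ, h2, one_mul]
      have hiter : ∀ (y : F) (s i : ℕ), y ^ 2 ^ s = y → y ^ 2 ^ (s * i) = y := by
        intro y s i h
        induction i with
        | zero => simp
        | succ i ih => rw [mul_add_one, pow_add, pow_mul, ih, h]
      have hnorm : x ^ (2 ^ (d * j) + 1) = x ^ (2 ^ d + 1) := by
        obtain ⟨i, rfl⟩ := hj
        rw [pow_succ, pow_succ x, show d * (2 * i + 1) = d * 2 * i + d by ring, pow_add 2,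
          pow_mul, hiter x _ i hx2]
      have hfix : (x ^ (2 ^ d + 1)) ^ 2 ^ d = x ^ (2 ^ d + 1) := by
        rw [← pow_mul, add_mul, ← pow_add, one_mul, ← mul_two, pow_add x, hx2, pow_succ,
          mul_comm]
      rw [hnorm]
      exact binaryChar_eq_one_of_pow_two_pow_eq_self (m := d * k) (by ring) (hiter _ d k hfix)
  · have h := gcd_dvd_sum_units_pow (F := F) (2 ^ (d * j) + 1)
      fun u => binaryChar (d * (2 * k)) (u : F)
    rw [hF, gcd_two_pow_sub_one_two_pow_add_one hjk] at h
    rw [sum_eq_zero_add_sum_units, zero_pow (Nat.succ_ne_zero _), binaryChar_zero, add_sub_cancel_left]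
    simpa using h

end GoldSum


/-- Corrected Lemma 7 (Theorem 5.3(ii) of Coulter, corrected): if `e/d` is even,
`a` is a `(2^d+1)`-th power in `F_q^*`, `b ≠ 0`, and `x₀` solves
`a^{2^α} x^{2^{2α}} + a x = b^{2^α}`, then
`S_α(a,b) = -(-1)^{m/d} 2^{m+d} χ₁(a x₀^{2^α+1})`. -/
theorem stmt_0
    (e α : ℕ) (he : 0 < e) (hα : 0 < α)
    (d m : ℕ) (hd : d = Nat.gcd e α) (hm : e = 2 * m)
    (heven : Even (e / d))
    (F : Type) [Field F] [Fintype F] [DecidableEq F]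
    (hF : Fintype.card F = 2 ^ e)
    (Tr : F → F) (hTr : ∀ x, Tr x = ∑ i ∈ Finset.range e, x ^ 2 ^ i)
    (χ : F → ℤ) (hχ : ∀ x, χ x = if Tr x = 0 then 1 else -1)
    (S : F → F → ℤ)
    (hS : ∀ a b : F, S a b = ∑ x : F, χ (a * x ^ (2 ^ α + 1) + b * x))
    (a b : F) (ha : a ≠ 0) (hb : b ≠ 0)
    (c : F) (hc : c ≠ 0) (hac : a = c ^ (2 ^ d + 1))
    (x₀ : F)
    (hx₀ : a ^ 2 ^ α * x₀ ^ 2 ^ (2 * α) + a * x₀ = b ^ 2 ^ α) :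
    S a b = -(-1 : ℤ) ^ (m / d) * 2 ^ (m + d) * χ (a * x₀ ^ (2 ^ α + 1)) := by
  have : Fact (Nat.Prime 2) := ⟨Nat.prime_two⟩
  have : CharP F 2 := charP_of_card_eq_prime_pow hF
  obtain rfl : χ = binaryChar e := funext fun x => by rw [hχ, hTr, binaryChar]
  have hd0 : 0 < d := hd ▸ Nat.gcd_pos_of_pos_left _ he
  obtain ⟨k, hk⟩ := heven
  obtain ⟨j, hj⟩ : d ∣ α := hd ▸ Nat.gcd_dvd_right e α
  have hde : d ∣ e := hd ▸ Nat.gcd_dvd_left e α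
  have hek : e = d * (2 * k) := by rw [two_mul, ← hk, Nat.mul_div_cancel' hde]
  have hmk : m = d * k := by
    have : 2 * m = 2 * (d * k) := by rw [← hm, hek]; ring
    omega
  have hk0 : 0 < k := Nat.pos_of_ne_zero fun h => by simp [hek, h] at he
  have hjk : j.Coprime (2 * k) := by
    have h : d * 1 = d * (2 * k).gcd j := by rw [← Nat.gcd_mul_left, ← hek, ← hj, mul_one, hd]
    exact (Nat.coprime_comm.1 (Nat.eq_of_mul_eq_mul_left hd0 h).symm)
  obtain ⟨u, hu, hau⟩ := exists_pow_eq_of_gcd hc (2 ^ α + 1)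
  rw [hF, hek, hj, gcd_two_pow_sub_one_two_pow_add_one hjk, ← hac, ← hj] at hau
  have hS0 : ∑ x : F, binaryChar e (a * x ^ (2 ^ α + 1)) = -(-1) ^ k * 2 ^ (d * k + d) := by
    have hscale := Equiv.sum_comp (Equiv.mulLeft₀ u hu)
      fun x => binaryChar e (x ^ (2 ^ α + 1))
    simp only [Equiv.mulLeft₀_apply, mul_pow, ← hau] at hscale
    rw [hscale]
    have h := sum_binaryChar_pow hd0 hk0 hjk (hek ▸ hF)
    rwa [← hek, ← hj] at h
  rw [hS, ← Equiv.sum_comp (Equiv.addRight x₀)]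
  simp only [Equiv.coe_addRight, binaryChar_shift hF α hx₀]
  rw [← Finset.sum_mul, hS0, hmk, Nat.mul_div_cancel_left k hd0]
end

section
/- Suppose e/d is even. Let a ∈ F_q^* be a (2^d+1)-th power in F_q^* (i.e., a = c^{2^d+1} for some c ∈ F_q^*), let b ∈ F_q^*, and define f(x) = a^{2^α}·x^{2^{2α}} + a·x. If the equation f(x) = b^{2^α} has no solution x ∈ F_q, then S_α(a,b) = 0. -/
section TwoPowerField

variable {F : Type} [Field F]

lemma sum_pow_two_pow_add [CharP F 2] (e : ℕ) (x y : F) :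
    ∑ i ∈ Finset.range e, (x + y) ^ 2 ^ i =
      ∑ i ∈ Finset.range e, x ^ 2 ^ i + ∑ i ∈ Finset.range e, y ^ 2 ^ i := by
  simp only [add_pow_char_pow, Finset.sum_add_distrib]

lemma sum_pow_two_pow_sq [Fintype F] {e : ℕ} (hF : Fintype.card F = 2 ^ e) (x : F) :
    ∑ i ∈ Finset.range e, (x ^ 2) ^ 2 ^ i = ∑ i ∈ Finset.range e, x ^ 2 ^ i := by
  have h := Finset.sum_range_succ (fun i => x ^ 2 ^ i) e
  rw [Finset.sum_range_succ', ← hF, FiniteField.pow_card, pow_zero, pow_one] at h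
  simpa only [← pow_mul, ← pow_succ'] using add_right_cancel h

lemma sum_pow_two_pow_eq_zero_or_one [CharP F 2] [Fintype F] {e : ℕ}
    (hF : Fintype.card F = 2 ^ e) (x : F) :
    ∑ i ∈ Finset.range e, x ^ 2 ^ i = 0 ∨ ∑ i ∈ Finset.range e, x ^ 2 ^ i = 1 := by
  have h : (∑ i ∈ Finset.range e, x ^ 2 ^ i) ^ 2 = ∑ i ∈ Finset.range e, x ^ 2 ^ i := by
    rw [sum_pow_char, ← sum_pow_two_pow_sq hF x]
    simp only [← pow_mul, mul_comm]
  exact IsIdempotentElem.iff_eq_zero_or_one.mp ((pow_two _).symm.trans h)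

lemma exists_sum_pow_two_pow_ne_zero [Fintype F] {e : ℕ} (he : 0 < e)
    (hF : Fintype.card F = 2 ^ e) : ∃ x : F, ∑ i ∈ Finset.range e, x ^ 2 ^ i ≠ 0 := by
  by_contra! h
  obtain ⟨n, rfl⟩ : ∃ n, e = n + 1 := ⟨e - 1, by omega⟩
  let p : Polynomial F := ∑ i ∈ Finset.range (n + 1), Polynomial.X ^ 2 ^ i
  have hdeg : p.natDegree < Fintype.card F := by
    rw [hF]
    refine lt_of_le_of_lt (Polynomial.natDegree_sum_le_of_forall_le (n := 2 ^ n) _ _ ?_)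
      (Nat.pow_lt_pow_right one_lt_two n.lt_succ_self)
    intro i hi
    rw [Polynomial.natDegree_X_pow]
    exact Nat.pow_le_pow_right two_pos (Finset.mem_range_succ_iff.mp hi)
  have hp : p = 0 := Polynomial.eq_zero_of_natDegree_lt_card_of_eval_eq_zero p
    Function.injective_id (fun x => by simpa [p, Polynomial.eval_finsetSum] using h x) hdeg
  have hc : p.coeff 1 = 1 := by
    rw [Polynomial.finsetSum_coeff, Finset.sum_eq_single 0]
    · simp
    · intro i _ hi
      rw [Polynomial.coeff_X_pow, if_neg]
      exact (Nat.one_lt_two_pow hi).ne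
    · simp
  simp [hp] at hc

lemma pow_two_pow_gcd {m n : ℕ} {u : F} (hm : u ^ 2 ^ m = u) (hn : u ^ 2 ^ n = u) :
    u ^ 2 ^ m.gcd n = u := by
  have iter (k : ℕ) : (fun x : F => x ^ 2)^[k] u = u ^ 2 ^ k := by
    rw [pow_iterate]
  have := Function.IsPeriodicPt.gcd (f := fun x : F => x ^ 2) (x := u)
    ((iter m).trans hm) ((iter n).trans hn)
  exact (iter _).symm.trans this

lemma sum_pow_two_pow_eq_zero [CharP F 2] {d m : ℕ} (hdm : d ∣ m) {u : F} (hu : u ^ 2 ^ d = u) :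
    ∑ i ∈ Finset.range (m + m), u ^ 2 ^ i = 0 := by
  have hm : u ^ 2 ^ m = u := by
    obtain ⟨k, rfl⟩ := hdm
    induction k with
    | zero => simp
    | succ k ih => rw [mul_add, mul_one, pow_add, pow_mul, ih, hu]
  rw [Finset.sum_range_add]
  simp only [pow_add, pow_mul, hm, CharTwo.add_self_eq_zero]

end TwoPowerField


/-- If `e/d` is even, `a` is a `(2^d+1)`-th power in `F_q^*`, `b ≠ 0`, and the equation
`a^{2^α} x^{2^{2α}} + a x = b^{2^α}` has no solution in `F_q`, then `S_α(a,b) = 0`. -/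
theorem stmt_1
    (e α : ℕ) (he : 0 < e) (hα : 0 < α)
    (d : ℕ) (hd : d = Nat.gcd e α)
    (heven : Even (e / d))
    (F : Type) [Field F] [Fintype F] [DecidableEq F]
    (hF : Fintype.card F = 2 ^ e)
    (Tr : F → F) (hTr : ∀ x, Tr x = ∑ i ∈ Finset.range e, x ^ 2 ^ i)
    (χ : F → ℤ) (hχ : ∀ x, χ x = if Tr x = 0 then 1 else -1)
    (S : F → F → ℤ)
    (hS : ∀ a b : F, S a b = ∑ x : F, χ (a * x ^ (2 ^ α + 1) + b * x))
    (a b : F) (ha : a ≠ 0) (hb : b ≠ 0)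
    (c : F) (hc : c ≠ 0) (hac : a = c ^ (2 ^ d + 1))
    (hnosol : ∀ x : F, a ^ 2 ^ α * x ^ 2 ^ (2 * α) + a * x ≠ b ^ 2 ^ α) :
    S a b = 0 := by
  have : Fact (Nat.Prime 2) := ⟨Nat.prime_two⟩
  have : CharP F 2 := charP_of_card_eq_prime_pow hF
  have htwo (x : F) : x + x = 0 := CharTwo.add_self_eq_zero x
  have Tadd (x y : F) : Tr (x + y) = Tr x + Tr y := by
    simp only [hTr, sum_pow_two_pow_add]
  have Tpow (n : ℕ) (x : F) : Tr (x ^ 2 ^ n) = Tr x := by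
    induction n with
    | zero => simp
    | succ n ih => rw [pow_succ, pow_mul, hTr, sum_pow_two_pow_sq hF, ← hTr, ih]
  have T01 (x : F) : Tr x = 0 ∨ Tr x = 1 := by
    simpa only [hTr] using sum_pow_two_pow_eq_zero_or_one hF x
  have χadd (x y : F) : χ (x + y) = χ x * χ y := by
    simp only [hχ, Tadd]
    rcases T01 x with h | h <;> rcases T01 y with h' | h' <;> simp [h, h', htwo]
  have χpow (n : ℕ) (x : F) : χ (x ^ 2 ^ n) = χ x := by simp only [hχ, Tpow]
  have χzero : χ 0 = 1 := by simp [hχ, hTr]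
  obtain ⟨t, ht⟩ := exists_sum_pow_two_pow_ne_zero he hF
  have χt : χ t = -1 := by rw [hχ, hTr, if_neg ht]
  have orth (z : F) : ∑ x : F, χ (z * x) = if z = 0 then (Fintype.card F : ℤ) else 0 := by
    split_ifs with hz
    · simp [hz, χzero]
    · have h := Equiv.sum_comp (Equiv.addRight (z⁻¹ * t)) fun x => χ (z * x)
      simp only [Equiv.coe_addRight, mul_add, mul_inv_cancel_left₀ hz, χadd, χt] at h
      rw [← Finset.sum_mul] at h
      linarith
  let f : F → F := fun x => a ^ 2 ^ α * x ^ 2 ^ (2 * α) + a * x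
  have pow_pow_two (x : F) : (x ^ 2 ^ α) ^ 2 ^ α = x ^ 2 ^ (2 * α) := by
    rw [← pow_mul, ← pow_add, two_mul]
  have adj (x w : F) : χ (f w * x ^ 2 ^ α) = χ (a * (x ^ 2 ^ α * w + x * w ^ 2 ^ α)) := by
    have h₁ : f w * x ^ 2 ^ α = (a * (w ^ 2 ^ α * x)) ^ 2 ^ α + a * (x ^ 2 ^ α * w) := by
      simp only [f, mul_pow, pow_pow_two]
      ring
    rw [h₁, χadd, χpow, ← χadd]
    congr 1
    ring
  have bij : Function.Bijective fun x : F => x ^ 2 ^ α :=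
    Finite.injective_iff_bijective.mp (iterateFrobenius F 2 α).injective
  have orth_pow (z : F) :
      ∑ x : F, χ (z * x ^ 2 ^ α) = if z = 0 then (Fintype.card F : ℤ) else 0 := by
    rw [← orth, bij.sum_comp fun x => χ (z * x)]
  have χker (w : F) (hw : f w = 0) : χ (a * w ^ (2 ^ α + 1)) = 1 := by
    have hfix : (a * w ^ (2 ^ α + 1)) ^ 2 ^ α = a * w ^ (2 ^ α + 1) := by
      have h : a ^ 2 ^ α * w ^ 2 ^ (2 * α) = a * w := CharTwo.add_eq_zero.mp hw
      calc (a * w ^ (2 ^ α + 1)) ^ 2 ^ α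
          = a ^ 2 ^ α * w ^ 2 ^ (2 * α) * w ^ 2 ^ α := by
            rw [pow_succ, mul_pow, mul_pow, pow_pow_two, mul_assoc]
        _ = a * w ^ (2 ^ α + 1) := by rw [h]; ring
    have hfix' := pow_two_pow_gcd (by rw [← hF, FiniteField.pow_card]) hfix (m := e)
    rw [← hd] at hfix'
    obtain ⟨k, hk⟩ := heven
    have hde : d ∣ e := hd ▸ Nat.gcd_dvd_left e α
    have hek : e = d * k + d * k := by rw [← mul_add, ← hk, Nat.mul_div_cancel' hde]
    rw [hχ, hTr, hek, sum_pow_two_pow_eq_zero (Dvd.intro k rfl) hfix', if_pos rfl]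
  have ksum : ∑ w : F, χ (b * w) * (if f w = 0 then (Fintype.card F : ℤ) else 0) = 0 := by
    have inner (x : F) : ∑ w : F, χ ((f x + b ^ 2 ^ α) * w ^ 2 ^ α) = 0 := by
      rw [orth_pow, if_neg]
      exact fun h => hnosol x (CharTwo.add_eq_zero.mp h)
    calc ∑ w : F, χ (b * w) * (if f w = 0 then (Fintype.card F : ℤ) else 0)
        = ∑ w : F, ∑ x : F, χ ((f x + b ^ 2 ^ α) * w ^ 2 ^ α) := by
          refine Finset.sum_congr rfl fun w _ => ?_
          rw [← orth_pow, Finset.mul_sum]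
          refine Finset.sum_congr rfl fun x _ => ?_
          rw [add_mul (f x), χadd, ← mul_pow, χpow, adj, adj, mul_comm]
          congr 2
          ring
      _ = 0 := by
          rw [Finset.sum_comm]
          exact Finset.sum_eq_zero fun x _ => inner x
  have square : S a b * S a b =
      ∑ w : F, χ (b * w) * (if f w = 0 then (Fintype.card F : ℤ) else 0) := by
    have expand (x w : F) :
        χ (a * x ^ (2 ^ α + 1) + b * x) * χ (a * (w + x) ^ (2 ^ α + 1) + b * (w + x)) =
          χ (a * w ^ (2 ^ α + 1) + b * w) * χ (f w * x ^ 2 ^ α) := by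
      rw [adj, ← χadd, ← χadd]
      congr 1
      rw [pow_succ (w + x), add_pow_char_pow]
      linear_combination htwo (a * x ^ (2 ^ α + 1) + b * x)
    calc S a b * S a b
        = ∑ x : F, ∑ w : F,
            χ (a * x ^ (2 ^ α + 1) + b * x) *
              χ (a * (w + x) ^ (2 ^ α + 1) + b * (w + x)) := by
          rw [hS, Finset.sum_mul_sum]
          refine Finset.sum_congr rfl fun x _ => ?_
          exact (Equiv.sum_comp (Equiv.addRight x) fun y =>
            χ (a * x ^ (2 ^ α + 1) + b * x) * χ (a * y ^ (2 ^ α + 1) + b * y)).symm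
      _ = ∑ w : F, χ (a * w ^ (2 ^ α + 1) + b * w) *
            (if f w = 0 then (Fintype.card F : ℤ) else 0) := by
          simp only [expand]
          rw [Finset.sum_comm]
          simp only [← Finset.mul_sum, orth_pow]
      _ = _ := by
          refine Finset.sum_congr rfl fun w _ => ?_
          split_ifs with hw
          · rw [χadd, χker w hw, one_mul]
          · simp
  exact mul_self_eq_zero.mp (square.trans ksum)
end

section
/- Suppose e/d is even and a ∈ F_q^* is a (2^d+1)-th power in F_q^* (i.e., a = c^{2^d+1} for some c ∈ F_q^*). Then the F_2-linear map f : F_q → F_q given by f(x) = a^{2^α}·x^{2^{2α}} + a·x has exactly 2^{2d} roots in F_q; equivalently, its kernel has F_2-dimension 2d and its image has F_2-dimension e − 2d. -/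
theorem Nat.gcd_two_mul_right_of_even_div_gcd {e α : ℕ} (he : 0 < e)
    (h : Even (e / e.gcd α)) : e.gcd (2 * α) = 2 * e.gcd α := by
  obtain ⟨d, e', α', hd, hcop, rfl, rfl⟩ := Nat.exists_coprime' (m := e) (n := α)
    (Nat.gcd_pos_of_pos_left _ he)
  have hg : (e' * d).gcd (α' * d) = d := by
    rw [Nat.gcd_mul_right, hcop.gcd_eq_one, one_mul]
  rw [hg, Nat.mul_div_cancel _ hd] at h
  obtain ⟨m, rfl⟩ := h.two_dvd
  rw [hg, ← mul_assoc, Nat.gcd_mul_right, Nat.gcd_mul_left,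
    (hcop.coprime_dvd_left (Dvd.intro_left 2 rfl)).gcd_eq_one, mul_one]

theorem Nat.gcd_two_pow_add_one_dvd {e α : ℕ} (he : 0 < e)
    (h : e.gcd (2 * α) = 2 * e.gcd α) :
    (2 ^ e - 1).gcd (2 ^ α + 1) ∣ 2 ^ e.gcd α + 1 := by
  set d := e.gcd α with hd
  set g := (2 ^ e - 1).gcd (2 ^ α + 1) with hg
  have hg1 : g ∣ 2 ^ e - 1 := Nat.gcd_dvd_left _ _
  have hg2 : g ∣ 2 ^ α + 1 := Nat.gcd_dvd_right _ _
  have hsq (n : ℕ) : 2 ^ (2 * n) - 1 = (2 ^ n + 1) * (2 ^ n - 1) := by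
    rw [mul_comm 2 n, pow_mul, ← Nat.sq_sub_sq, one_pow]
  have hdvd : g ∣ (2 ^ d + 1) * (2 ^ d - 1) := by
    rw [← hsq, ← h, ← Nat.pow_sub_one_gcd_pow_sub_one]
    exact Nat.dvd_gcd hg1 (hsq α ▸ hg2.mul_right _)
  refine Nat.Coprime.dvd_of_dvd_mul_right ?_ hdvd
  have hodd : Odd g := by
    refine Odd.of_dvd_nat ?_ hg1
    exact Nat.Even.sub_odd Nat.one_le_two_pow (even_two.pow_of_ne_zero he.ne') odd_one
  refine Nat.Coprime.symm (Nat.coprime_of_dvd fun p hp hp1 hp2 => ?_)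
  have h1 : p ∣ 2 ^ α - 1 :=
    hp1.trans (Nat.pow_sub_one_dvd_pow_sub_one _ (Nat.gcd_dvd_right e α))
  have h2 : p ∣ 2 ^ α + 1 := hp2.trans hg2
  have h3 : p ∣ 2 := by
    have := Nat.dvd_sub h2 h1
    have h4 := Nat.one_le_two_pow (n := α)
    rwa [show 2 ^ α + 1 - (2 ^ α - 1) = 2 by omega] at this
  rw [(Nat.prime_dvd_prime_iff_eq hp Nat.prime_two).1 h3] at hp2
  exact (Nat.not_even_iff_odd.2 hodd) (even_iff_two_dvd.2 hp2)

theorem exists_pow_eq_pow_of_gcd_dvd {G : Type*} [Group G] (c : G) {k t : ℕ}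
    (h : (Nat.card G).gcd k ∣ t) : ∃ b : G, b ^ k = c ^ t := by
  obtain ⟨m, rfl⟩ := h
  refine ⟨c ^ ((Nat.card G).gcdB k * m), ?_⟩
  rw [← zpow_natCast, ← zpow_natCast, ← zpow_mul, Nat.cast_mul, Nat.gcd_eq_gcd_ab, add_mul,
    zpow_add, mul_assoc (Nat.card G : ℤ), zpow_mul c (Nat.card G : ℤ), zpow_natCast c,
    pow_card_eq_one', one_zpow, one_mul]
  congr 1
  ring

theorem FiniteField.card_filter_pow_eq_self {F : Type*} [Field F] [Fintype F] [DecidableEq F]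
    {p e : ℕ} (hp : 0 < p) (hF : Fintype.card F = p ^ e) (k : ℕ) :
    (Finset.univ.filter fun x : F => x ^ p ^ k = x).card = p ^ e.gcd k := by
  have hpk (n : ℕ) : 1 ≤ p ^ n := Nat.one_le_pow _ _ hp
  have hker : (Finset.univ.filter fun u : Fˣ => u ^ (p ^ k - 1) = 1).card
      = p ^ e.gcd k - 1 := by
    have h := IsCyclic.card_powMonoidHom_ker (G := Fˣ) (p ^ k - 1)
    rw [Nat.card_units, Nat.card_eq_fintype_card (α := F), hF, Nat.pow_sub_one_gcd_pow_sub_one] at h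
    rw [← h, ← Fintype.card_subtype, ← Nat.card_eq_fintype_card]
    rfl
  have hset : (Finset.univ.filter fun x : F => x ^ p ^ k = x) =
      insert 0 ((Finset.univ.filter fun u : Fˣ => u ^ (p ^ k - 1) = 1).map
        ⟨Units.val, Units.val_injective⟩) := by
    ext x
    rcases eq_or_ne x 0 with rfl | hx
    · simp [hp.ne']
    · have hx1 : x ^ p ^ k = x ↔ x ^ (p ^ k - 1) = 1 := by
        conv_lhs => rw [← Nat.sub_add_cancel (hpk k), pow_succ]
        exact mul_eq_right₀ hx
      simp only [Finset.mem_filter, Finset.mem_univ, true_and, Finset.mem_insert, hx, false_or,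
        Finset.mem_map, Function.Embedding.coeFn_mk, hx1]
      constructor
      · exact fun h => ⟨Units.mk0 x hx, Units.ext (by simpa using h), rfl⟩
      · rintro ⟨u, hu, rfl⟩
        rw [← Units.val_pow_eq_pow_val, hu, Units.val_one]
  rw [hset, Finset.card_insert_of_notMem (by simp), Finset.card_map, hker,
    Nat.sub_add_cancel (hpk _)]

theorem AddMonoidHom.card_filter_eq_zero_mul_card_image {A B : Type*} [AddGroup A] [AddGroup B]
    [Fintype A] [DecidableEq B] (φ : A →+ B) :
    (Finset.univ.filter fun x => φ x = 0).card * (Finset.univ.image φ).card =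
      Fintype.card A := by
  have h := φ.ker.card_mul_index
  rw [AddSubgroup.index_ker, Nat.card_eq_fintype_card (α := A)] at h
  rw [← h]
  congr 1
  · rw [← Fintype.card_subtype, ← Nat.card_eq_fintype_card]
    rfl
  · rw [← Set.ncard_coe_finset, Finset.coe_image, Finset.coe_univ, Set.image_univ]
    rfl

/-- If `e/d` is even and `a` is a `(2^d+1)`-th power in `F_q^*`, then the `F_2`-linear map
`f(x) = a^{2^α} x^{2^{2α}} + a x` has exactly `2^{2d}` roots in `F_q`; equivalently its
kernel has `F_2`-dimension `2d` (i.e. `2^{2d}` elements) and its image has `F_2`-dimension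
`e - 2d` (i.e. `2^{e-2d}` elements). -/
theorem stmt_2
    (e α : ℕ) (he : 0 < e) (hα : 0 < α)
    (d : ℕ) (hd : d = Nat.gcd e α)
    (heven : Even (e / d))
    (F : Type) [Field F] [Fintype F] [DecidableEq F]
    (hF : Fintype.card F = 2 ^ e)
    (a : F) (ha : a ≠ 0)
    (c : F) (hc : c ≠ 0) (hac : a = c ^ (2 ^ d + 1))
    (f : F → F) (hf : ∀ x, f x = a ^ 2 ^ α * x ^ 2 ^ (2 * α) + a * x) :
    (Finset.univ.filter fun x : F => f x = 0).card = 2 ^ (2 * d) ∧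
    (Finset.univ.image f).card = 2 ^ (e - 2 * d) := by
  subst hd
  have : Fact (Nat.Prime 2) := ⟨Nat.prime_two⟩
  have : CharP F 2 := charP_of_card_eq_prime_pow hF
  have hgcd := Nat.gcd_two_mul_right_of_even_div_gcd he heven
  obtain ⟨b, hb0, hab⟩ : ∃ b : F, b ≠ 0 ∧ a = b ^ (2 ^ α + 1) := by
    obtain ⟨b, hb⟩ := exists_pow_eq_pow_of_gcd_dvd (Units.mk0 c hc)
      (k := 2 ^ α + 1) (t := 2 ^ e.gcd α + 1) (by
        rw [Nat.card_units, Nat.card_eq_fintype_card, hF]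
        exact Nat.gcd_two_pow_add_one_dvd he hgcd)
    refine ⟨b, b.ne_zero, ?_⟩
    rw [hac, ← Units.val_pow_eq_pow_val, hb]
    simp
  have hfactor (x : F) : f x = b ^ 2 ^ α * ((b * x) ^ 2 ^ (2 * α) + b * x) := by
    rw [hf, hab, ← pow_mul, mul_pow, two_mul, pow_add 2 α α]
    ring
  have hker : (Finset.univ.filter fun x : F => f x = 0).card = 2 ^ (2 * e.gcd α) := by
    rw [← hgcd, ← FiniteField.card_filter_pow_eq_self two_pos hF]
    refine Finset.card_bijective (b * ·) (mulLeft_bijective₀ b hb0) fun x => ?_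
    simp [hfactor, hb0, CharTwo.add_eq_zero]
  refine ⟨hker, ?_⟩
  let φ : F →+ F := AddMonoidHom.mk' f fun x y => by
    rw [hf, hf, hf, add_pow_char_pow]
    ring
  have hcard : (Finset.univ.filter fun x : F => f x = 0).card * (Finset.univ.image f).card
      = Fintype.card F := φ.card_filter_eq_zero_mul_card_image
  have hle : 2 * e.gcd α ≤ e := hgcd ▸ Nat.gcd_le_left _ he
  rw [hker, hF, ← pow_mul_pow_sub 2 hle] at hcard
  exact Nat.eq_of_mul_eq_mul_left (by positivity) hcard
end

section
/- Suppose e/d is even. Let a ∈ F_q^* and let β ∈ F_q^* satisfy a^{2^α}·β^{2^{2α}} + a·β = 0. Then (a·β^{2^α+1})^{2^d − 1} = 1; that is, a·β^{2^α+1} lies in the subfield of F_q with 2^d elements, and consequently Tr_d(a·β^{2^α+1}) = 0. -/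
theorem pow_sub_one_eq_one_of_pow_eq_self {K : Type*} [Field K] {x : K} (hx : x ≠ 0) {n : ℕ}
    (hn : 0 < n) (h : x ^ n = x) : x ^ (n - 1) = 1 := by
  refine mul_right_cancel₀ hx ?_
  rw [← pow_succ, Nat.sub_add_cancel hn, h, one_mul]


/-- If `e/d` is even, `a ∈ F_q^*`, `β ∈ F_q^*` and `a^{2^α} β^{2^{2α}} + a β = 0`, then
`(a β^{2^α+1})^{2^d-1} = 1` (so `a β^{2^α+1}` lies in the subfield with `2^d` elements)
and consequently `Tr_d(a β^{2^α+1}) = 0`. -/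
theorem stmt_3
    (e α : ℕ) (he : 0 < e) (hα : 0 < α)
    (d : ℕ) (hd : d = Nat.gcd e α)
    (heven : Even (e / d))
    (F : Type) [Field F] [Fintype F]
    (hF : Fintype.card F = 2 ^ e)
    (Trd : F → F) (hTrd : ∀ x, Trd x = ∑ i ∈ Finset.range (e / d), x ^ 2 ^ (d * i))
    (a β : F) (ha : a ≠ 0) (hβ : β ≠ 0)
    (hfβ : a ^ 2 ^ α * β ^ 2 ^ (2 * α) + a * β = 0) :
    (a * β ^ (2 ^ α + 1)) ^ (2 ^ d - 1) = 1 ∧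
    Trd (a * β ^ (2 ^ α + 1)) = 0 := by
  subst hd
  have : Fact (Nat.Prime 2) := ⟨Nat.prime_two⟩
  have : CharP F 2 := charP_of_card_eq_prime_pow hF
  have hab : a ^ 2 ^ α * β ^ 2 ^ (2 * α) = a * β := CharTwo.add_eq_zero.mp hfβ
  rw [hTrd]
  set x := a * β ^ (2 ^ α + 1) with hx
  have hx0 : x ≠ 0 := mul_ne_zero ha (pow_ne_zero _ hβ)
  have hxα : x ^ 2 ^ α = x := by
    calc x ^ 2 ^ α = a ^ 2 ^ α * β ^ 2 ^ (2 * α) * β ^ 2 ^ α := by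
          rw [hx, two_mul, pow_add 2 α α]; ring
      _ = x := by rw [hab, hx]; ring
  have hxe : x ^ 2 ^ e = x := hF ▸ FiniteField.pow_card x
  have hd1 : x ^ (2 ^ Nat.gcd e α - 1) = 1 := by
    rw [← Nat.pow_sub_one_gcd_pow_sub_one]
    exact pow_gcd_eq_one.mpr
      ⟨pow_sub_one_eq_one_of_pow_eq_self hx0 (by positivity) hxe,
        pow_sub_one_eq_one_of_pow_eq_self hx0 (by positivity) hxα⟩
  have hfix : x ^ 2 ^ Nat.gcd e α = x := by
    rw [← Nat.sub_add_cancel (Nat.one_le_two_pow (n := Nat.gcd e α)), pow_succ, hd1, one_mul]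
  have hiter (i : ℕ) : x ^ 2 ^ (Nat.gcd e α * i) = x := by
    induction i with
    | zero => simp
    | succ i ih => rw [Nat.mul_succ, pow_add 2, pow_mul, ih, hfix]
  refine ⟨hd1, ?_⟩
  simp only [hiter, Finset.sum_const, Finset.card_range, nsmul_eq_mul]
  rw [(CharP.cast_eq_zero_iff F 2 _).mpr heven.two_dvd, zero_mul]
end

section
/- Let a ∈ F_q^* and take b = 0. For every (u,v) ∈ F_q² with (u,v) ≠ (0,0): if v ≠ 0 then wt(c_{(u,v)}) = (q/4)·(q + S(a,0)), and if v = 0 (so u ≠ 0) then wt(c_{(u,v)}) = (q/4)·(q + S(a,0) − S(a,u)). -/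
/-- The polynomial expression of the absolute trace on a field with `2 ^ e` elements is additive,
takes values in `{0, 1}`, and is nondegenerate. -/
theorem absTrace_properties {F : Type*} [Field F] [Fintype F] {e : ℕ}
    (hF : Fintype.card F = 2 ^ e) {Tr : F → F}
    (hTr : ∀ x, Tr x = ∑ i ∈ Finset.range e, x ^ 2 ^ i) :
    (∀ x y, Tr (x + y) = Tr x + Tr y) ∧ (∀ x, Tr x = 0 ∨ Tr x = 1) ∧
      ∀ u, u ≠ 0 → ∃ z, Tr (u * z) = 1 := by
  have zmod_two : ∀ t : ZMod 2, t = 0 ∨ t = 1 := by decide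
  have : Fact (Nat.Prime 2) := ⟨Nat.prime_two⟩
  have : CharP F 2 := charP_of_card_eq_prime_pow hF
  let _ : Algebra (ZMod 2) F := ZMod.algebra F 2
  have hrank : Module.finrank (ZMod 2) F = e := by
    have h := Module.card_eq_pow_finrank (K := ZMod 2) (V := F)
    rw [hF, ZMod.card] at h
    exact (Nat.pow_right_injective le_rfl h).symm
  have key : ∀ x, Tr x = algebraMap (ZMod 2) F (Algebra.trace (ZMod 2) F x) := fun x => by
    rw [hTr, FiniteField.algebraMap_trace_eq_sum_pow, hrank, Nat.card_zmod]
  refine ⟨fun x y => by simp [key], fun x => ?_, fun u hu => ?_⟩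
  · rcases zmod_two (Algebra.trace (ZMod 2) F x) with h | h <;> simp [key, h]
  · by_contra! hne
    refine hu ((traceForm_nondegenerate (ZMod 2) F).1 u fun z => ?_)
    rw [Algebra.traceForm_apply]
    refine (zmod_two _).resolve_right fun h => hne z ?_
    rw [key, h, map_one]

/-- If `χ` turns sums into products and takes the value `-1` at a multiple of `u`, then
`x ↦ χ (u * x)` sums to zero. -/
theorem sum_mul_eq_zero_of_map_add {F : Type*} [Field F] [Fintype F] {χ : F → ℤ}
    (hadd : ∀ x y, χ (x + y) = χ x * χ y) {u z : F} (hz : χ (u * z) = -1) :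
    ∑ x, χ (u * x) = 0 := by
  have h : ∑ x, χ (u * (x + z)) = ∑ x, χ (u * x) :=
    Equiv.sum_comp (Equiv.addRight z) fun x => χ (u * x)
  simp only [mul_add, hadd, hz, ← Finset.sum_mul] at h
  linarith


/-- Weights for `b = 0`: if `v ≠ 0` then `wt(c_{(u,v)}) = (q/4)(q + S(a,0))`, and if
`v = 0` (with `u ≠ 0`) then `wt(c_{(u,v)}) = (q/4)(q + S(a,0) − S(a,u))`. -/
theorem stmt_5
    (e h : ℕ) (hdvd : h ∣ e) (hh0 : 0 < h) (hhe : h < e)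
    (F : Type) [Field F] [Fintype F] [DecidableEq F]
    (hF : Fintype.card F = 2 ^ e)
    (q : ℤ) (hq : q = 2 ^ e)
    (Tr : F → F) (hTr : ∀ x, Tr x = ∑ i ∈ Finset.range e, x ^ 2 ^ i)
    (S : F → F → ℤ)
    (hS : ∀ a b : F, S a b = ∑ x : F,
        if Tr (a * x ^ (2 ^ h + 1) + b * x) = 0 then (1 : ℤ) else -1)
    (a : F) (ha : a ≠ 0)
    (D : Finset (F × F))
    (hD : D = Finset.univ.filter fun p : F × F =>
        p ≠ (0, 0) ∧ Tr (a * p.1 ^ (2 ^ h + 1)) = 0)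
    (wt : F × F → ℕ)
    (hwt : ∀ u v : F, wt (u, v) =
        (D.filter fun p => Tr (u * p.1 + v * p.2) = 1).card) :
    ∀ u v : F, (u, v) ≠ ((0 : F), (0 : F)) →
      (v ≠ 0 → (wt (u, v) : ℤ) = q / 4 * (q + S a 0)) ∧
      (v = 0 → (wt (u, v) : ℤ) = q / 4 * (q + S a 0 - S a u)) := by
  have he : 2 ≤ e := by omega
  obtain ⟨hadd, h01, hnd⟩ := absTrace_properties hF hTr
  have hTr0 : Tr 0 = 0 := by simpa using hadd 0 0
  set χ : F → ℤ := fun x => if Tr x = 0 then 1 else -1 with hχ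
  have two_eq_zero : (1 : F) + 1 = 0 := by
    have : Fact (Nat.Prime 2) := ⟨Nat.prime_two⟩
    have : CharP F 2 := charP_of_card_eq_prime_pow hF
    exact CharTwo.add_self_eq_zero 1
  have χadd : ∀ x y, χ (x + y) = χ x * χ y := fun x y => by
    rcases h01 x with hx | hx <;> rcases h01 y with hy | hy <;> simp [hχ, hadd, hx, hy, two_eq_zero]
  have χ0 : χ 0 = 1 := by simp [hχ, hTr0]
  have χsum : ∀ u, u ≠ 0 → ∑ x, χ (u * x) = 0 := fun u hu => by
    obtain ⟨z, hz⟩ := hnd u hu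
    exact sum_mul_eq_zero_of_map_add χadd (z := z) (by simp [hχ, hz])
  have hcard : ∑ _x : F, (1 : ℤ) = q := by
    rw [Finset.sum_const, Finset.card_univ, hF, hq]; simp
  have hS' : ∀ b, S a b = ∑ x, χ (a * x ^ (2 ^ h + 1)) * χ (b * x) := fun b => by
    simp_rw [← χadd]
    exact hS a b
  have hS0 : S a 0 = ∑ x, χ (a * x ^ (2 ^ h + 1)) := by simp [hS', χ0]
  have hwt4 : ∀ u v : F, 4 * (wt (u, v) : ℤ) =
      ∑ x, (1 + χ (a * x ^ (2 ^ h + 1))) * ∑ y, (1 - χ (u * x) * χ (v * y)) := fun u v => by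
    rw [hwt, hD, Finset.filter_filter, Finset.card_filter]
    push_cast
    simp only [Finset.mul_sum]
    rw [Fintype.sum_prod_type]
    refine Finset.sum_congr rfl fun x _ => Finset.sum_congr rfl fun y _ => ?_
    rw [← χadd]
    have hne : Tr (u * x + v * y) = 1 → (x, y) ≠ ((0 : F), (0 : F)) := by
      rintro h1 h2
      obtain ⟨rfl, rfl⟩ := Prod.mk.inj h2
      simp [hTr0] at h1
    rcases h01 (a * x ^ (2 ^ h + 1)) with h1 | h1 <;> rcases h01 (u * x + v * y) with h2 | h2
    · simp [hχ, h1, h2]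
    · simp [hχ, h1, h2, hne h2]
    · simp [hχ, h1, h2]
    · simp [hχ, h1, h2]
  have hq4 : 4 * (q / 4) = q :=
    Int.mul_ediv_cancel' (hq ▸ pow_dvd_pow (2 : ℤ) he)
  intro u v huv
  have h4 := hwt4 u v
  simp only [Finset.sum_sub_distrib, hcard, ← Finset.mul_sum] at h4
  refine ⟨fun hv => ?_, fun hv => ?_⟩
  · have h5 : 4 * (wt (u, v) : ℤ) = (q + S a 0) * q := by
      simpa [χsum v hv, ← Finset.sum_mul, Finset.sum_add_distrib, hcard, hS0] using h4
    linarith [congrArg (· * (q + S a 0)) hq4]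
  · subst hv
    have hu : u ≠ 0 := by rintro rfl; exact huv rfl
    have h5 : 4 * (wt (u, 0) : ℤ) = (q + S a 0 - S a u) * q := by
      calc 4 * (wt (u, 0) : ℤ)
          = ∑ x, (1 + χ (a * x ^ (2 ^ h + 1)) - χ (u * x)
              - χ (a * x ^ (2 ^ h + 1)) * χ (u * x)) * q := by
            rw [h4]
            refine Finset.sum_congr rfl fun x _ => ?_
            simp only [zero_mul, χ0, hcard]
            ring
        _ = _ := by
            rw [← Finset.sum_mul, Finset.sum_sub_distrib, Finset.sum_sub_distrib,
              Finset.sum_add_distrib, hcard, χsum u hu, ← hS0, ← hS', sub_zero]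
    linarith [congrArg (· * (q + S a 0 - S a u)) hq4]
end

section
/- Let a ∈ F_q^* and b ∈ F_q^*. For every (u,v) ∈ F_q² with (u,v) ≠ (0,0): if v ≠ b then wt(c_{(u,v)}) = q²/4, and if v = b then wt(c_{(u,v)}) = (q/4)·(q − S(a,u)). -/
open Finset

/-- The absolute trace of a finite field of order `2 ^ e`, as an additive map to `ZMod 2`,
detects where the power sum `∑ i < e, x ^ 2 ^ i` takes the values `0` and `1`. -/
theorem exists_addMonoidHom_trace {F : Type*} [Field F] [Fintype F] {e : ℕ}
    (hF : Fintype.card F = 2 ^ e) :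
    CharP F 2 ∧ ∃ t : F →+ ZMod 2, (∃ z, t z = 1) ∧
      ∀ x, (∑ i ∈ range e, x ^ 2 ^ i = 0 ↔ t x = 0) ∧ (∑ i ∈ range e, x ^ 2 ^ i = 1 ↔ t x = 1) := by
  have hchar : CharP F 2 := by
    obtain ⟨p, hp⟩ := CharP.exists F
    obtain ⟨n, hprime, hcard⟩ := FiniteField.card F p
    have : p ∣ 2 ^ e := hF ▸ hcard ▸ dvd_pow_self p n.pos.ne'
    rwa [(Nat.prime_dvd_prime_iff_eq hprime Nat.prime_two).1 (hprime.dvd_of_dvd_pow this)] at hp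
  let _ : Algebra (ZMod 2) F := ZMod.algebra F 2
  have hrank : Module.finrank (ZMod 2) F = e := by
    have := Module.card_eq_pow_finrank (K := ZMod 2) (V := F)
    rw [hF, ZMod.card] at this
    exact (Nat.pow_right_injective le_rfl this).symm
  have htr (x : F) :
      ∑ i ∈ range e, x ^ 2 ^ i = algebraMap (ZMod 2) F (Algebra.trace (ZMod 2) F x) := by
    rw [FiniteField.algebraMap_trace_eq_sum_pow, hrank, Nat.card_zmod]
  have hinj := (algebraMap (ZMod 2) F).injective
  refine ⟨hchar, (Algebra.trace (ZMod 2) F).toAddMonoidHom,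
    Algebra.trace_surjective (ZMod 2) F 1, fun x => ?_⟩
  rw [htr]
  exact ⟨map_eq_zero_iff _ hinj, map_eq_one_iff _ hinj⟩

/-- The sign `(-1) ^ z` of an element `z` of `ZMod 2`. -/
def zmodTwoSign (z : ZMod 2) : ℤ := if z = 0 then 1 else -1

theorem zmodTwoSign_add (y z : ZMod 2) :
    zmodTwoSign (y + z) = zmodTwoSign y * zmodTwoSign z := by
  revert y z; decide

theorem four_mul_indicator_eq (y z : ZMod 2) :
    4 * (if y = 0 ∧ z = 1 then (1 : ℤ) else 0) =
      1 + zmodTwoSign y - zmodTwoSign z - zmodTwoSign (y + z) := by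
  revert y z; decide

theorem sum_zmodTwoSign_eq_zero {G : Type*} [AddGroup G] [Fintype G] (t : G →+ ZMod 2) {z : G}
    (hz : t z = 1) : ∑ x, zmodTwoSign (t x) = 0 := by
  have hshift := Equiv.sum_comp (Equiv.addRight z) fun x => zmodTwoSign (t x)
  have hneg : zmodTwoSign 1 = -1 := by decide
  simp only [Equiv.coe_addRight, map_add, zmodTwoSign_add, hz, hneg, mul_neg, mul_one,
    sum_neg_distrib] at hshift
  lia

theorem sum_zmodTwoSign_mul_left {F : Type*} [Field F] [Fintype F] {t : F →+ ZMod 2} {z : F}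
    (hz : t z = 1) {c : F} (hc : c ≠ 0) : ∑ x, zmodTwoSign (t (c * x)) = 0 :=
  sum_zmodTwoSign_eq_zero (t.comp (AddMonoidHom.mulLeft c)) (z := c⁻¹ * z)
    (by simpa [mul_inv_cancel_left₀ hc] using hz)

theorem sum_prod_zmodTwoSign {F : Type*} [Field F] [Fintype F] (t : F →+ ZMod 2) (f : F → F)
    (c : F) : ∑ p : F × F, zmodTwoSign (t (f p.1 + c * p.2)) =
      (∑ x, zmodTwoSign (t (f x))) * ∑ y, zmodTwoSign (t (c * y)) := by
  simp only [map_add, zmodTwoSign_add, Fintype.sum_prod_type, sum_mul_sum]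

/-- The number of solutions of `t (f x + b y) = 0`, `t (u x + v y) = 1` in terms of
exponential sums. -/
theorem four_mul_card_filter_eq {F : Type*} [Field F] [Fintype F] {t : F →+ ZMod 2}
    {z : F} (hz : t z = 1) (f : F → F) {b u v : F} (hb : b ≠ 0) (huv : (u, v) ≠ (0, 0)) :
    4 * (#{p : F × F | t (f p.1 + b * p.2) = 0 ∧ t (u * p.1 + v * p.2) = 1} : ℤ) =
      (Fintype.card F : ℤ) ^ 2 -
        (∑ x, zmodTwoSign (t (f x + u * x))) * ∑ y, zmodTwoSign (t ((b + v) * y)) := by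
  have hzero : (∑ x, zmodTwoSign (t (u * x))) * ∑ y, zmodTwoSign (t (v * y)) = 0 := by
    by_cases hu : u = 0
    · have hv : v ≠ 0 := by rintro rfl; exact huv (by rw [hu])
      rw [sum_zmodTwoSign_mul_left hz hv, mul_zero]
    · rw [sum_zmodTwoSign_mul_left hz hu, zero_mul]
  rw [natCast_card_filter, mul_sum]
  simp only [four_mul_indicator_eq, ← map_add, sum_sub_distrib, sum_add_distrib]
  simp only [show ∀ p : F × F, f p.1 + b * p.2 + (u * p.1 + v * p.2) =
    (f p.1 + u * p.1) + (b + v) * p.2 from fun p => by ring]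
  rw [sum_prod_zmodTwoSign t f b, sum_prod_zmodTwoSign t (fun x => u * x) v,
    sum_prod_zmodTwoSign t (fun x => f x + u * x) (b + v), sum_zmodTwoSign_mul_left hz hb, hzero]
  simp [sq]


/-- Weights for `b ≠ 0`: if `v ≠ b` then `wt(c_{(u,v)}) = q²/4`, and if `v = b` then
`wt(c_{(u,v)}) = (q/4)(q − S(a,u))`. -/
theorem stmt_6
    (e h : ℕ) (hdvd : h ∣ e) (hh0 : 0 < h) (hhe : h < e)
    (F : Type) [Field F] [Fintype F] [DecidableEq F]
    (hF : Fintype.card F = 2 ^ e)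
    (q : ℤ) (hq : q = 2 ^ e)
    (Tr : F → F) (hTr : ∀ x, Tr x = ∑ i ∈ Finset.range e, x ^ 2 ^ i)
    (S : F → F → ℤ)
    (hS : ∀ a b : F, S a b = ∑ x : F,
        if Tr (a * x ^ (2 ^ h + 1) + b * x) = 0 then (1 : ℤ) else -1)
    (a b : F) (ha : a ≠ 0) (hb : b ≠ 0)
    (D : Finset (F × F))
    (hD : D = Finset.univ.filter fun p : F × F =>
        p ≠ (0, 0) ∧ Tr (a * p.1 ^ (2 ^ h + 1) + b * p.2) = 0)
    (wt : F × F → ℕ)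
    (hwt : ∀ u v : F, wt (u, v) =
        (D.filter fun p => Tr (u * p.1 + v * p.2) = 1).card) :
    ∀ u v : F, (u, v) ≠ ((0 : F), (0 : F)) →
      (v ≠ b → (wt (u, v) : ℤ) = q ^ 2 / 4) ∧
      (v = b → (wt (u, v) : ℤ) = q / 4 * (q - S a u)) := by
  intro u v huv
  obtain ⟨hchar, t, ⟨z, hz⟩, ht⟩ := exists_addMonoidHom_trace hF
  simp only [← hTr] at ht
  have hq4 : (4 : ℤ) ∣ q := by
    rw [hq]
    exact pow_dvd_pow (2 : ℤ) (show 2 ≤ e by lia)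
  have hcard : (Fintype.card F : ℤ) = q := by rw [hF, hq]; norm_cast
  have hS' : S a u = ∑ x, zmodTwoSign (t (a * x ^ (2 ^ h + 1) + u * x)) := by
    simp only [hS, (ht _).1, zmodTwoSign]
  have hfilter : (D.filter fun p => Tr (u * p.1 + v * p.2) = 1) =
      ({p | t (a * p.1 ^ (2 ^ h + 1) + b * p.2) = 0 ∧ t (u * p.1 + v * p.2) = 1} :
        Finset (F × F)) := by
    ext p
    simp only [hD, mem_filter, mem_univ, true_and, (ht _).1, (ht _).2, and_assoc]
    refine ⟨And.right, fun hp => ⟨?_, hp⟩⟩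
    rintro rfl
    simpa using hp.2
  have hwt4 := four_mul_card_filter_eq hz (fun x => a * x ^ (2 ^ h + 1)) hb huv
  rw [← hfilter, ← hwt, ← hS', hcard] at hwt4
  refine ⟨fun hvb => ?_, fun hvb => ?_⟩
  · have hbv : b + v ≠ 0 := by rwa [Ne, CharTwo.add_eq_zero, eq_comm]
    rw [sum_zmodTwoSign_mul_left hz hbv, mul_zero, sub_zero] at hwt4
    lia
  · obtain ⟨k, rfl⟩ := hq4
    simp only [hvb, CharTwo.add_self_eq_zero, zero_mul, map_zero, zmodTwoSign, if_true, sum_const,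
      card_univ, nsmul_eq_mul, mul_one, hcard] at hwt4
    rw [hvb, Int.mul_ediv_cancel_left k four_ne_zero]
    linarith
end

section
/- Assume e/h is even and write e = 2m. Let b = 0 and let a ∈ F_q^* NOT be a (2^h+1)-th power in F_q^* (i.e., a ≠ c^{2^h+1} for all c ∈ F_q^*). Then |D_{(a,0)}| = (q/2)·(q + (−1)^{m/h}·2^m) − 1, and among the q² − 1 pairs (u,v) ≠ (0,0), exactly q·(q−1) pairs satisfy wt(c_{(u,v)}) = (q/4)·(q + (−1)^{m/h}·2^m), exactly q/2 + (−1)^{m/h}·2^{m−1} − 1 pairs satisfy wt(c_{(u,v)}) = q²/4, and exactly q/2 − (−1)^{m/h}·2^{m−1} pairs satisfy wt(c_{(u,v)}) = (q/4)·(q + (−1)^{m/h}·2^{m+1}); no other nonzero weights occur. -/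
open Finset

theorem dvd_sum_comp_pow {G : Type*} [CommGroup G] [IsCyclic G] [Fintype G] [DecidableEq G]
    {n : ℕ} (hn : n ∣ Fintype.card G) (f : G → ℤ) : (n : ℤ) ∣ ∑ x, f (x ^ n) := by
  rw [Finset.sum_comp f (fun x : G => x ^ n)]
  refine Finset.dvd_sum fun y hy => ?_
  obtain ⟨x, -, hx⟩ := Finset.mem_image.mp hy
  have h1 : #{g : G | powMonoidHom n g = y} = #{g : G | powMonoidHom n g = 1} :=
    MonoidHom.card_fiber_eq_of_mem_range (powMonoidHom n : G →* G) ⟨x, hx⟩ ⟨1, map_one _⟩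
  have h2 : #{g : G | powMonoidHom n g = 1} = n := by
    have := IsCyclic.card_powMonoidHom_ker (G := G) n
    rw [Nat.card_eq_fintype_card, Nat.card_eq_fintype_card, Nat.gcd_eq_right hn] at this
    rw [Fintype.card_subtype] at this
    simpa only [MonoidHom.mem_ker] using this
  simp only [powMonoidHom_apply] at h1 h2
  rw [h1, h2, nsmul_eq_mul]
  exact dvd_mul_right _ _

theorem IsCyclic.exists_pow_eq_of_pow_eq_one {G : Type*} [CommGroup G] [IsCyclic G] [Finite G]
    {n k : ℕ} (hk : 0 < k) (hnk : n * k ∣ Nat.card G) {z : G} (hz : z ^ k = 1) :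
    ∃ w : G, w ^ n = z := by
  obtain ⟨g, hg⟩ := IsCyclic.exists_monoid_generator (α := G)
  obtain ⟨j, rfl⟩ := hg z
  have hord : orderOf g = Nat.card G := by
    refine orderOf_eq_card_of_forall_mem_zpowers fun x => ?_
    obtain ⟨i, rfl⟩ := hg x
    exact ⟨i, by simp⟩
  simp only [← pow_mul] at hz
  have h1 : n * k ∣ j * k := hnk.trans (hord ▸ orderOf_dvd_of_pow_eq_one hz)
  obtain ⟨i, rfl⟩ := Nat.dvd_of_mul_dvd_mul_right hk h1
  exact ⟨g ^ i, by rw [← pow_mul, mul_comm]⟩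

theorem two_pow_add_one_mul_dvd {h e : ℕ} (h2 : 2 * h ∣ e) :
    (2 ^ h + 1) * (2 ^ h - 1) ∣ 2 ^ e - 1 := by
  obtain ⟨k, rfl⟩ := h2
  have := Nat.sub_dvd_pow_sub_pow (2 ^ (2 * h)) 1 k
  rw [one_pow, ← pow_mul] at this
  convert this using 1
  have := Nat.sq_sub_sq (2 ^ h) 1
  rw [← this, mul_comm 2 h, pow_mul, one_pow]

/-- The linearised polynomial of `Tr (a * x ^ (2 ^ h + 1))` has no nonzero root. -/
theorem linearized_ne_zero {F : Type*} [Field F] [Fintype F] [DecidableEq F] [CharP F 2] {e h : ℕ} (hh0 : 0 < h)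
    (h2 : 2 * h ∣ e) (hF : Fintype.card F = 2 ^ e) {a : F} (ha : a ≠ 0)
    (ha' : ∀ c : F, c ≠ 0 → a ≠ c ^ (2 ^ h + 1)) {y : F} (hy : y ≠ 0) :
    a * y + a ^ 2 ^ h * y ^ (2 ^ h * 2 ^ h) ≠ 0 := by
  intro h0
  obtain ⟨k, hk⟩ : ∃ k, 2 ^ h = k + 1 := ⟨2 ^ h - 1, by have := Nat.one_le_two_pow (n := h); omega⟩
  have hk0 : 0 < k := by
    have := Nat.one_lt_two_pow hh0.ne'
    omega
  have h1 : a * y = a ^ 2 ^ h * y ^ (2 ^ h * 2 ^ h) := by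
    rw [← sub_eq_zero, CharTwo.sub_eq_add]; exact h0
  have hz : (a * y ^ (2 ^ h + 1)) ^ k = 1 := by
    rw [hk] at h1 ⊢
    have hne : a * y ≠ 0 := mul_ne_zero ha hy
    apply mul_left_cancel₀ hne
    rw [mul_one]
    conv_rhs => rw [h1]
    ring
  have hz0 : a * y ^ (2 ^ h + 1) ≠ 0 := mul_ne_zero ha (pow_ne_zero _ hy)
  have hd := two_pow_add_one_mul_dvd h2
  rw [← hF, hk, Nat.add_sub_cancel] at hd
  obtain ⟨w, hw⟩ := IsCyclic.exists_pow_eq_of_pow_eq_one (G := Fˣ) (n := 2 ^ h + 1) hk0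
    (by rw [Nat.card_eq_fintype_card, Fintype.card_units, hk]; exact hd)
    (z := Units.mk0 _ hz0) (by ext; simpa using hz)
  have hw' : (w : F) ^ (2 ^ h + 1) = a * y ^ (2 ^ h + 1) := by
    have := congrArg Units.val hw
    simpa using this
  refine ha' (w / y) (div_ne_zero w.ne_zero hy) ?_
  rw [div_pow, hw', mul_div_cancel_right₀ _ (pow_ne_zero _ hy)]

section TraceCharacter

variable {F : Type*} [Field F] [Fintype F]

theorem trace_zero_or_one [CharP F 2] {e : ℕ} (hF : Fintype.card F = 2 ^ e) (x : F) :
    ∑ i ∈ range e, x ^ 2 ^ i = 0 ∨ ∑ i ∈ range e, x ^ 2 ^ i = 1 := by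
  have h1 : (∑ i ∈ range e, x ^ 2 ^ i) ^ 2 = ∑ i ∈ range e, x ^ 2 ^ i := by
    rw [sum_pow_char 2]
    have h2 := Finset.sum_range_succ (fun i => x ^ 2 ^ i) e
    rw [Finset.sum_range_succ', ← hF, FiniteField.pow_card] at h2
    simp only [pow_zero, pow_one, add_left_inj] at h2
    rw [← h2]
    exact Finset.sum_congr rfl fun i _ => by rw [← pow_mul, pow_succ]
  have h3 : (∑ i ∈ range e, x ^ 2 ^ i) * ((∑ i ∈ range e, x ^ 2 ^ i) - 1) = 0 := by
    rw [mul_sub, ← sq, h1, mul_one, sub_self]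
  exact (mul_eq_zero.mp h3).imp id sub_eq_zero.mp

theorem exists_trace_ne_zero {e : ℕ} (he : 0 < e) (hF : Fintype.card F = 2 ^ e) :
    ∃ x : F, ∑ i ∈ range e, x ^ 2 ^ i ≠ 0 := by
  by_contra! hall
  obtain ⟨k, rfl⟩ : ∃ k, e = k + 1 := ⟨e - 1, by omega⟩
  let p : Polynomial F := ∑ i ∈ range (k + 1), Polynomial.X ^ 2 ^ i
  have hlt : ∀ j, (∑ i ∈ range j, (Polynomial.X : Polynomial F) ^ 2 ^ i).degree < (2 ^ j : ℕ) := by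
    intro j
    refine (Polynomial.degree_sum_le _ _).trans_lt ?_
    rw [Finset.sup_lt_iff (by exact WithBot.bot_lt_coe _)]
    intro i hi
    rw [Polynomial.degree_X_pow]
    exact_mod_cast Nat.pow_lt_pow_right (by norm_num) (mem_range.mp hi)
  have hp : p = 0 := by
    refine Polynomial.eq_zero_of_degree_lt_of_eval_finset_eq_zero (s := univ) ?_ ?_
    · rw [Finset.card_univ, hF]
      exact hlt _
    · intro x _
      simpa [p, Polynomial.eval_finsetSum] using hall x
  have hd : p.degree = (2 ^ k : ℕ) := by
    simp only [p]
    rw [Finset.sum_range_succ, Polynomial.degree_add_eq_right_of_degree_lt] <;>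
      rw [Polynomial.degree_X_pow]
    exact hlt k
  rw [hp, Polynomial.degree_zero] at hd
  exact WithBot.bot_ne_coe hd

/-- The canonical additive character `x ↦ (-1) ^ Tr x`. -/
theorem exists_trace_addChar [DecidableEq F] [CharP F 2] {e : ℕ} (he : 0 < e) (hF : Fintype.card F = 2 ^ e) :
    ∃ ψ : AddChar F ℤ, ψ.IsPrimitive ∧ (∀ x, ψ (x ^ 2) = ψ x) ∧
      ∀ x, ψ x = if ∑ i ∈ range e, x ^ 2 ^ i = 0 then 1 else -1 := by
  let ψ : AddChar F ℤ :=
    { toFun := fun x => if ∑ i ∈ range e, x ^ 2 ^ i = 0 then 1 else -1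
      map_zero_eq_one' := by simp
      map_add_eq_mul' := by
        intro x y
        have hadd : ∑ i ∈ range e, (x + y) ^ 2 ^ i =
            ∑ i ∈ range e, x ^ 2 ^ i + ∑ i ∈ range e, y ^ 2 ^ i := by
          rw [← Finset.sum_add_distrib]
          exact Finset.sum_congr rfl fun i _ => add_pow_char_pow ..
        rw [hadd]
        rcases trace_zero_or_one hF x with h | h <;> rcases trace_zero_or_one hF y with h' | h' <;>
          simp [h, h', CharTwo.add_self_eq_zero] }
  have hψ : ∀ x, ψ x = if ∑ i ∈ range e, x ^ 2 ^ i = 0 then 1 else -1 := fun _ => rfl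
  refine ⟨ψ, AddChar.IsPrimitive.of_ne_one ?_, fun x => ?_, hψ⟩
  · intro h1
    obtain ⟨x, hx⟩ := exists_trace_ne_zero he hF
    have := hψ x
    rw [h1, if_neg hx] at this
    norm_num at this
  · have : ∑ i ∈ range e, (x ^ 2) ^ 2 ^ i = (∑ i ∈ range e, x ^ 2 ^ i) ^ 2 := by
      rw [sum_pow_char 2]
      exact Finset.sum_congr rfl fun i _ => by rw [← pow_mul, ← pow_mul, mul_comm]
    rw [hψ, hψ, this]
    simp

end TraceCharacter

/-- The exponential sum `∑ x, ψ (a * x ^ n + u * x)`. -/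
def expSum {F : Type*} [Field F] [Fintype F] (ψ : AddChar F ℤ) (n : ℕ) (a u : F) : ℤ :=
  ∑ x, ψ (a * x ^ n + u * x)

section ExpSum

variable {F : Type*} [Field F] {ψ : AddChar F ℤ}

theorem AddChar.map_pow_two_pow (hsq : ∀ x, ψ (x ^ 2) = ψ x) (h : ℕ) (x : F) :
    ψ (x ^ 2 ^ h) = ψ x := by
  induction h with
  | zero => simp
  | succ k ih => rw [pow_succ, pow_mul, hsq, ih]

variable [Fintype F] [DecidableEq F]

theorem expSum_sq [CharP F 2] (hψ : ψ.IsPrimitive) (hsq : ∀ x, ψ (x ^ 2) = ψ x) {h : ℕ} {a : F}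
    (hL : ∀ y : F, y ≠ 0 → a * y + a ^ 2 ^ h * y ^ (2 ^ h * 2 ^ h) ≠ 0) (u : F) :
    expSum ψ (2 ^ h + 1) a u ^ 2 = Fintype.card F := by
  set g : F → F := fun x => a * x ^ (2 ^ h + 1) + u * x with hg
  have hpair : ∀ x y, ψ (g x) * ψ (g (x + y)) =
      ψ (g y) * ψ (x ^ 2 ^ h * (a * y + a ^ 2 ^ h * y ^ (2 ^ h * 2 ^ h))) := by
    intro x y
    have h1 : g x + g (x + y) = g y + (a * y * x ^ 2 ^ h + a * x * y ^ 2 ^ h) := by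
      simp only [hg, pow_succ, add_pow_char_pow]
      linear_combination (CharTwo.add_self_eq_zero (a * (x ^ 2 ^ h * x) + u * x))
    have h2 : ψ (a * x * y ^ 2 ^ h) = ψ (x ^ 2 ^ h * (a ^ 2 ^ h * y ^ (2 ^ h * 2 ^ h))) := by
      rw [← AddChar.map_pow_two_pow hsq h]
      congr 1
      rw [mul_pow, mul_pow, ← pow_mul]
      ring
    rw [← AddChar.map_add_eq_mul, h1, AddChar.map_add_eq_mul, AddChar.map_add_eq_mul _ (a * y * _),
      h2, ← AddChar.map_add_eq_mul]
    congr 2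
    ring
  have hbij : Function.Bijective fun x : F => x ^ 2 ^ h :=
    Finite.injective_iff_bijective.mp (iterateFrobenius_inj F 2 h)
  calc expSum ψ (2 ^ h + 1) a u ^ 2 = ∑ x, ∑ y, ψ (g x) * ψ (g y) := by
        rw [sq, expSum, Finset.sum_mul_sum]
    _ = ∑ x, ∑ y, ψ (g x) * ψ (g (x + y)) :=
        Finset.sum_congr rfl fun x _ =>
          (Equiv.sum_comp (Equiv.addLeft x) fun y => ψ (g x) * ψ (g y)).symm
    _ = ∑ y, ψ (g y) * ∑ x, ψ (x ^ 2 ^ h * (a * y + a ^ 2 ^ h * y ^ (2 ^ h * 2 ^ h))) := by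
        rw [Finset.sum_comm]
        simp only [hpair, Finset.mul_sum]
    _ = ∑ y, ψ (g y) * if y = 0 then (Fintype.card F : ℤ) else 0 := by
        refine Finset.sum_congr rfl fun y _ => ?_
        rw [hbij.sum_comp fun x => ψ (x * (a * y + a ^ 2 ^ h * y ^ (2 ^ h * 2 ^ h))),
          AddChar.sum_mulShift _ hψ]
        by_cases hy : y = 0
        · simp [hy]
        · simp [hy, hL y hy]
    _ = Fintype.card F := by simp [hg]

theorem dvd_expSum_zero_sub_one {n : ℕ} (hn0 : n ≠ 0) (hn : n ∣ Fintype.card F - 1) (a : F) :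
    (n : ℤ) ∣ expSum ψ n a 0 - 1 := by
  have h1 : expSum ψ n a 0 = 1 + ∑ x : Fˣ, ψ (a * ((x ^ n : Fˣ) : F)) := by
    simp only [expSum, zero_mul, add_zero]
    rw [← Finset.add_sum_erase univ _ (mem_univ (0 : F))]
    congr 1
    · simp [hn0]
    · symm
      refine Finset.sum_bij (fun x _ => (x : F)) (by simp) (fun _ _ _ _ h => Units.ext h) ?_
        (by simp)
      intro b hb
      exact ⟨Units.mk0 b (Finset.ne_of_mem_erase hb), mem_univ _, rfl⟩
  rw [h1, add_sub_cancel_left]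
  exact dvd_sum_comp_pow (by rwa [Fintype.card_units]) fun x : Fˣ => ψ (a * (x : F))

theorem sum_expSum (hψ : ψ.IsPrimitive) {n : ℕ} (hn0 : n ≠ 0) (a : F) :
    ∑ u, expSum ψ n a u = Fintype.card F := by
  simp only [expSum, AddChar.map_add_eq_mul]
  rw [Finset.sum_comm]
  simp only [← Finset.mul_sum, AddChar.sum_mulShift _ hψ]
  simp [hn0]

theorem expSum_zero_eq [CharP F 2] (hψ : ψ.IsPrimitive) (hsq : ∀ x, ψ (x ^ 2) = ψ x)
    {h k : ℕ} (hh0 : 0 < h) (hF : Fintype.card F = 2 ^ (2 * (h * k))) {a : F}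
    (hL : ∀ y : F, y ≠ 0 → a * y + a ^ 2 ^ h * y ^ (2 ^ h * 2 ^ h) ≠ 0) :
    expSum ψ (2 ^ h + 1) a 0 = (-1) ^ k * 2 ^ (h * k) := by
  have h1 := expSum_sq hψ hsq hL 0
  have hd : 2 ^ h + 1 ∣ Fintype.card F - 1 := by
    rw [hF]
    exact (dvd_mul_right _ _).trans (two_pow_add_one_mul_dvd ⟨k, by ring⟩)
  have h2 := dvd_expSum_zero_sub_one (ψ := ψ) (Nat.succ_ne_zero (2 ^ h)) hd a
  have h3 : ((2 : ℤ) ^ h + 1) ∣ 2 ^ (h * k) - (-1) ^ k := by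
    have := sub_dvd_pow_sub_pow ((2 : ℤ) ^ h) (-1) k
    rwa [← pow_mul, sub_neg_eq_add] at this
  have h4 : (2 : ℤ) < 2 ^ h + 1 := by
    have : (1 : ℤ) < 2 ^ h := one_lt_pow₀ (by norm_num) hh0.ne'
    omega
  have hε : ((-1 : ℤ) ^ k) * (-1) ^ k = 1 := by rw [← mul_pow]; simp
  have h5 : ((2 : ℤ) ^ h + 1) ∣ (-1) ^ k * 2 ^ (h * k) - 1 := by
    have := h3.mul_left ((-1) ^ k)
    rwa [mul_sub, hε] at this
  have h6 : expSum ψ (2 ^ h + 1) a 0 ^ 2 = ((-1) ^ k * 2 ^ (h * k)) ^ 2 := by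
    rw [h1, hF, mul_pow, sq ((-1 : ℤ) ^ k), hε]
    push_cast
    ring
  rcases sq_eq_sq_iff_eq_or_eq_neg.mp h6 with h7 | h7
  · exact h7
  · exfalso
    push_cast at h2
    rw [h7] at h2
    have h8 := dvd_add h2 h5
    have h9 : -((-1 : ℤ) ^ k * 2 ^ (h * k)) - 1 + ((-1) ^ k * 2 ^ (h * k) - 1) = -2 := by ring
    rw [h9, dvd_neg] at h8
    exact absurd (Int.le_of_dvd (by norm_num) h8) (by omega)

end ExpSum

section Weights

variable {F : Type*} [Field F] [Fintype F] [DecidableEq F] {ψ : AddChar F ℤ} {Tr : F → F}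

theorem two_mul_card_trace_eq_zero (hTr : ∀ x, ψ x = if Tr x = 0 then 1 else -1)
    {n : ℕ} (hn0 : n ≠ 0) (a : F) :
    2 * ((#{p : F × F | p ≠ (0, 0) ∧ Tr (a * p.1 ^ n) = 0} : ℤ) + 1) =
      Fintype.card F * (Fintype.card F + expSum ψ n a 0) := by
  have h0 : Tr 0 = 0 := by
    by_contra h
    have := hTr 0
    rw [if_neg h, AddChar.map_zero_eq_one] at this
    norm_num at this
  have h1 : ({p : F × F | p ≠ (0, 0) ∧ Tr (a * p.1 ^ n) = 0} : Finset (F × F)) =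
      ({p : F × F | Tr (a * p.1 ^ n) = 0} : Finset (F × F)).erase (0, 0) := by
    ext p
    simp
  have h2 : ((0, 0) : F × F) ∈ ({p : F × F | Tr (a * p.1 ^ n) = 0} : Finset (F × F)) := by
    simp [hn0, h0]
  have h3 := Finset.card_erase_add_one h2
  rw [← h1] at h3
  have h4 : (#{p : F × F | p ≠ (0, 0) ∧ Tr (a * p.1 ^ n) = 0} : ℤ) + 1 =
      #{p : F × F | Tr (a * p.1 ^ n) = 0} := by exact_mod_cast h3
  have h5 : ∀ p : F × F, 2 * (if Tr (a * p.1 ^ n) = 0 then (1 : ℤ) else 0) =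
      1 + ψ (a * p.1 ^ n) := by
    intro p
    rw [hTr]
    split_ifs <;> norm_num
  rw [h4, Finset.card_filter]
  push_cast
  rw [Finset.mul_sum, Finset.sum_congr rfl fun p _ => h5 p, Finset.sum_add_distrib,
    Fintype.sum_prod_type]
  simp only [expSum, Fintype.sum_prod_type, sum_const, card_univ, zero_mul, add_zero, nsmul_eq_mul,
    ← Finset.mul_sum]
  ring

theorem four_mul_card_trace_eq_one (hψ : ψ.IsPrimitive)
    (hTr : ∀ x, ψ x = if Tr x = 0 then 1 else -1) (hTr01 : ∀ x, Tr x = 0 ∨ Tr x = 1)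
    (n : ℕ) (a u v : F) :
    4 * (#{p ∈ ({p : F × F | p ≠ (0, 0) ∧ Tr (a * p.1 ^ n) = 0} : Finset (F × F)) |
        Tr (u * p.1 + v * p.2) = 1} : ℤ) =
      Fintype.card F * (Fintype.card F + expSum ψ n a 0) -
        ((if u = 0 then (Fintype.card F : ℤ) else 0) + expSum ψ n a u) *
          (if v = 0 then (Fintype.card F : ℤ) else 0) := by
  have h5 : ∀ p : F × F, 4 * (if (p ≠ (0, 0) ∧ Tr (a * p.1 ^ n) = 0) ∧
      Tr (u * p.1 + v * p.2) = 1 then (1 : ℤ) else 0) =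
      (1 + ψ (a * p.1 ^ n)) * (1 - ψ (u * p.1 + v * p.2)) := by
    intro p
    by_cases hp : p = (0, 0)
    · simp [hp]
    · rw [hTr (a * p.1 ^ n), hTr (u * p.1 + v * p.2)]
      rcases hTr01 (a * p.1 ^ n) with h | h <;>
        rcases hTr01 (u * p.1 + v * p.2) with h' | h' <;> simp [hp, h, h']
  have h6 : ∀ w : F, ∑ x, ψ (w * x) = if w = 0 then (Fintype.card F : ℤ) else 0 := by
    intro w
    simp only [mul_comm w, AddChar.sum_mulShift w hψ]
    split_ifs <;> simp
  rw [Finset.filter_filter, Finset.card_filter]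
  push_cast
  rw [Finset.mul_sum, Finset.sum_congr rfl fun p _ => h5 p, Fintype.sum_prod_type, ← h6 u, ← h6 v]
  have h7 : ∀ x, ∑ y, (1 + ψ (a * x ^ n)) * (1 - ψ (u * x + v * y)) =
      Fintype.card F * (1 + ψ (a * x ^ n)) -
        (ψ (u * x) + ψ (a * x ^ n + u * x)) * ∑ y, ψ (v * y) := by
    intro x
    simp only [AddChar.map_add_eq_mul, ← Finset.mul_sum, Finset.sum_sub_distrib, sum_const,
      card_univ, nsmul_eq_mul]
    ring
  simp only [h7, Finset.sum_sub_distrib, ← Finset.mul_sum, ← Finset.sum_mul,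
    Finset.sum_add_distrib, expSum, sum_const, card_univ, nsmul_eq_mul, zero_mul, add_zero]
  ring

/-- If `f` takes only the values `±s`, its sum determines how often each is attained. -/
theorem two_mul_card_filter_of_sum {ι : Type*} [Fintype ι] {f : ι → ℤ} {s : ℤ} (hs : s ≠ 0)
    (hf : ∀ i, f i = s ∨ f i = -s) :
    2 * s * #{i | f i = s} = Fintype.card ι * s + ∑ i, f i ∧
      2 * s * #{i | f i = -s} = Fintype.card ι * s - ∑ i, f i := by
  simp only [Finset.card_filter]
  push_cast
  have hcard : (Fintype.card ι : ℤ) * s = ∑ _i : ι, s := by simp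
  rw [hcard, Finset.mul_sum, Finset.mul_sum, ← Finset.sum_add_distrib, ← Finset.sum_sub_distrib]
  constructor <;> refine Finset.sum_congr rfl fun i _ => ?_ <;> rcases hf i with h | h <;> rw [h]
  · simp; ring
  · rw [if_neg (by omega)]; ring
  · rw [if_neg (by omega)]; ring
  · simp; ring

theorem card_filter_snd_ne_zero :
    (#{p : F × F | p.2 ≠ 0} : ℤ) = Fintype.card F * (Fintype.card F - 1) := by
  have : ({p : F × F | p.2 ≠ 0} : Finset (F × F)) = univ ×ˢ univ.erase 0 := by
    ext p
    simp
  rw [this, Finset.card_product, Finset.card_erase_of_mem (mem_univ _), Finset.card_univ,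
    Nat.cast_mul, Nat.cast_sub Fintype.card_pos, Nat.cast_one]

theorem card_filter_snd_eq_zero (P : F → Prop) [DecidablePred P] :
    #{p : F × F | p.2 = 0 ∧ P p.1} = #{u : F | P u} := by
  refine Finset.card_nbij' Prod.fst (fun u => (u, 0)) ?_ ?_ ?_ ?_ <;>
    simp +contextual [Set.MapsTo, Set.LeftInvOn, Prod.ext_iff]

end Weights

/-- Theorem 2(i): `e/h` even, `e = 2m`, `b = 0`, `a` not a `(2^h+1)`-th power. Then
`|D_{(a,0)}| = (q/2)(q + (−1)^{m/h} 2^m) − 1` and the weight distribution is: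
`q(q−1)` codewords of weight `(q/4)(q + (−1)^{m/h} 2^m)`,
`q/2 + (−1)^{m/h} 2^{m−1} − 1` of weight `q²/4`, and
`q/2 − (−1)^{m/h} 2^{m−1}` of weight `(q/4)(q + (−1)^{m/h} 2^{m+1})`;
no other nonzero weights occur. -/
theorem stmt_9
    (e h m : ℕ) (hdvd : h ∣ e) (hh0 : 0 < h) (hhe : h < e)
    (heven : Even (e / h)) (hm : e = 2 * m)
    (F : Type) [Field F] [Fintype F] [DecidableEq F]
    (hF : Fintype.card F = 2 ^ e)
    (q : ℤ) (hq : q = 2 ^ e)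
    (Tr : F → F) (hTr : ∀ x, Tr x = ∑ i ∈ Finset.range e, x ^ 2 ^ i)
    (a : F) (ha : a ≠ 0)
    (ha' : ∀ c : F, c ≠ 0 → a ≠ c ^ (2 ^ h + 1))
    (D : Finset (F × F))
    (hD : D = Finset.univ.filter fun p : F × F =>
        p ≠ (0, 0) ∧ Tr (a * p.1 ^ (2 ^ h + 1)) = 0)
    (wt : F × F → ℕ)
    (hwt : ∀ u v : F, wt (u, v) =
        (D.filter fun p => Tr (u * p.1 + v * p.2) = 1).card) :
    ((D.card : ℤ) = q / 2 * (q + (-1 : ℤ) ^ (m / h) * 2 ^ m) - 1) ∧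
    (((Finset.univ.filter fun uv : F × F =>
        uv ≠ (0, 0) ∧ (wt uv : ℤ) = q / 4 * (q + (-1 : ℤ) ^ (m / h) * 2 ^ m)).card : ℤ)
      = q * (q - 1)) ∧
    (((Finset.univ.filter fun uv : F × F =>
        uv ≠ (0, 0) ∧ (wt uv : ℤ) = q ^ 2 / 4).card : ℤ)
      = q / 2 + (-1 : ℤ) ^ (m / h) * 2 ^ (m - 1) - 1) ∧
    (((Finset.univ.filter fun uv : F × F =>
        uv ≠ (0, 0) ∧ (wt uv : ℤ) = q / 4 * (q + (-1 : ℤ) ^ (m / h) * 2 ^ (m + 1))).card : ℤ)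
      = q / 2 - (-1 : ℤ) ^ (m / h) * 2 ^ (m - 1)) ∧
    (∀ uv : F × F, uv ≠ (0, 0) →
      (wt uv : ℤ) = q / 4 * (q + (-1 : ℤ) ^ (m / h) * 2 ^ m) ∨
      (wt uv : ℤ) = q ^ 2 / 4 ∨
      (wt uv : ℤ) = q / 4 * (q + (-1 : ℤ) ^ (m / h) * 2 ^ (m + 1))) := by
  obtain ⟨k, hk⟩ := heven
  have he : e = h * (k + k) := by rw [← hk, Nat.mul_div_cancel' hdvd]
  have hmk : m = h * k := by
    have : 2 * m = 2 * (h * k) := by rw [← hm, he]; ring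
    omega
  have hdiv : m / h = k := by rw [hmk, Nat.mul_div_cancel_left _ hh0]
  have : Fact (Nat.Prime 2) := ⟨Nat.prime_two⟩
  have : CharP F 2 := charP_of_card_eq_prime_pow hF
  obtain ⟨ψ, hψ, hsq, hψTr⟩ := exists_trace_addChar (by omega : 0 < e) hF
  simp only [← hTr] at hψTr
  have hTr01 : ∀ x, Tr x = 0 ∨ Tr x = 1 := fun x => by
    rw [hTr]; exact trace_zero_or_one hF x
  have hL : ∀ y : F, y ≠ 0 → a * y + a ^ 2 ^ h * y ^ (2 ^ h * 2 ^ h) ≠ 0 :=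
    fun y hy => linearized_ne_zero hh0 ⟨k, by rw [he]; ring⟩ hF ha ha' hy
  have hS0 := expSum_zero_eq (k := k) hψ hsq hh0 (by rw [hF, hm, hmk]) hL
  have hSsq := fun u => expSum_sq hψ hsq hL u
  have hSsum := sum_expSum hψ (Nat.succ_ne_zero (2 ^ h)) a
  have hDcard := two_mul_card_trace_eq_zero hψTr (Nat.succ_ne_zero (2 ^ h)) a
  have hW := four_mul_card_trace_eq_one hψ hψTr hTr01 (2 ^ h + 1) a
  rw [← hD] at hDcard
  simp only [← hD, ← hwt] at hW
  rw [hdiv]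
  rw [← hmk] at hS0
  obtain ⟨m, rfl⟩ : ∃ j, m = j + 1 := ⟨m - 1, by omega⟩
  rw [Nat.add_sub_cancel]
  simp only [Nat.succ_eq_add_one] at hDcard hSsum
  set S := expSum ψ (2 ^ h + 1) a with hSdef
  set ε : ℤ := (-1) ^ k with hε
  have hε1 : ε * ε = 1 := by rw [hε, ← mul_pow]; simp
  set M : ℤ := 2 ^ m with hM
  have hMpos : 0 < M := by positivity
  have hεM : ε * M ≠ 0 := mul_ne_zero (left_ne_zero_of_mul_eq_one hε1) hMpos.ne'
  have hqM : q = 4 * M ^ 2 := by rw [hq, hm]; ring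
  have hFq : (Fintype.card F : ℤ) = q := by rw [hF, hq]; push_cast; rfl
  have hq2 : q / 2 = 2 * M ^ 2 := by omega
  have hq4 : q / 4 = M ^ 2 := by omega
  have hqq4 : q ^ 2 / 4 = 4 * M ^ 4 := by
    rw [hqM]; exact Int.ediv_eq_of_eq_mul_right (by norm_num) (by ring)
  have hp1 : (2 : ℤ) ^ (m + 1) = 2 * M := by rw [pow_succ, mul_comm]
  have hp2 : (2 : ℤ) ^ (m + 1 + 1) = 4 * M := by rw [pow_succ, hp1]; ring
  rw [hp1] at hS0
  rw [hFq] at hDcard hSsum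
  simp only [hFq] at hSsq hW
  have hS : ∀ u, S u = 2 * (ε * M) ∨ S u = -(2 * (ε * M)) := fun u => by
    apply sq_eq_sq_iff_eq_or_eq_neg.mp
    rw [hSsq u, hqM]
    linear_combination (-4 * M ^ 2) * hε1
  obtain ⟨hpos, hneg⟩ := two_mul_card_filter_of_sum (mul_ne_zero two_ne_zero hεM) hS
  rw [hSsum, hFq] at hpos hneg
  rw [hq2, hq4, hqq4, hp1, hp2]
  set W₁ : ℤ := M ^ 2 * (q + ε * (2 * M)) with hW₁
  set W₃ : ℤ := M ^ 2 * (q + ε * (4 * M)) with hW₃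
  have hεM3 : ε * M * M ^ 2 ≠ 0 := mul_ne_zero hεM (pow_ne_zero _ hMpos.ne')
  have h12 : W₁ ≠ 4 * M ^ 4 := fun h => hεM3 (by rw [hW₁, hqM] at h; linarith)
  have h13 : W₁ ≠ W₃ := fun h => hεM3 (by rw [hW₁, hW₃] at h; linarith)
  have h23 : 4 * M ^ 4 ≠ W₃ := fun h => hεM3 (by rw [hW₃, hqM] at h; linarith)
  have hwt₁ : ∀ u v, v ≠ 0 → (wt (u, v) : ℤ) = W₁ := fun u v hv => by
    have := hW u v
    rw [if_neg hv, hS0, hqM] at this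
    rw [hW₁, hqM]
    linarith
  have hwt₂ : ∀ u, u ≠ 0 → S u = 2 * (ε * M) → (wt (u, 0) : ℤ) = 4 * M ^ 4 := fun u hu hSu => by
    have := hW u 0
    rw [if_neg hu, if_pos rfl, hS0, hSu, hqM] at this
    linarith
  have hwt₃ : ∀ u, u ≠ 0 → S u = -(2 * (ε * M)) → (wt (u, 0) : ℤ) = W₃ := fun u hu hSu => by
    have := hW u 0
    rw [if_neg hu, if_pos rfl, hS0, hSu, hqM] at this
    rw [hW₃, hqM]
    linarith
  have hS0' : S 0 = 2 * (ε * M) := by rw [hS0]; ring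
  have hSne : 2 * (ε * M) ≠ -(2 * (ε * M)) := by omega
  have hf₁ : ∀ p : F × F, p ≠ (0, 0) ∧ (wt p : ℤ) = W₁ ↔ p.2 ≠ 0 := by
    rintro ⟨u, v⟩
    by_cases hv : v = 0
    · subst hv
      by_cases hu : u = 0
      · simp [hu]
      · rcases hS u with h | h
        · simp [hwt₂ u hu h, h12.symm]
        · simp [hwt₃ u hu h, h13.symm]
    · simp [hv, hwt₁ u v hv]
  have hf₂ : ∀ p : F × F, p ≠ (0, 0) ∧ (wt p : ℤ) = 4 * M ^ 4 ↔
      p.2 = 0 ∧ (p.1 ≠ 0 ∧ S p.1 = 2 * (ε * M)) := by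
    rintro ⟨u, v⟩
    by_cases hv : v = 0
    · subst hv
      by_cases hu : u = 0
      · simp [hu]
      · rcases hS u with h | h
        · simp [hwt₂ u hu h, h, hu]
        · simp [hwt₃ u hu h, h, hu, h23.symm, hSne.symm]
    · simp only [hwt₁ u v hv, hv, h12, and_false, false_and]
  have hf₃ : ∀ p : F × F, p ≠ (0, 0) ∧ (wt p : ℤ) = W₃ ↔
      p.2 = 0 ∧ S p.1 = -(2 * (ε * M)) := by
    rintro ⟨u, v⟩
    by_cases hv : v = 0
    · subst hv
      by_cases hu : u = 0
      · simp [hu, hS0', hSne]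
      · rcases hS u with h | h
        · simp [hwt₂ u hu h, h, hu, h23, hSne]
        · simp [hwt₃ u hu h, h, hu]
    · simp only [hwt₁ u v hv, hv, h13, and_false, false_and]
  simp only [hf₁, hf₂, hf₃]
  refine ⟨?_, ?_, ?_, ?_, ?_⟩
  · rw [hS0, hqM] at hDcard
    rw [hqM]
    linarith
  · rw [card_filter_snd_ne_zero, hFq]
  · rw [card_filter_snd_eq_zero fun u => u ≠ 0 ∧ S u = 2 * (ε * M)]
    have h1 : ({u : F | u ≠ 0 ∧ S u = 2 * (ε * M)} : Finset F) =
        ({u : F | S u = 2 * (ε * M)} : Finset F).erase 0 := by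
      ext u
      simp
    have h2 : (0 : F) ∈ ({u : F | S u = 2 * (ε * M)} : Finset F) := by simp [hS0']
    have h3 : ((#{u : F | u ≠ 0 ∧ S u = 2 * (ε * M)} : ℕ) : ℤ) + 1 =
        (#{u : F | S u = 2 * (ε * M)} : ℕ) := by
      rw [h1]; exact_mod_cast Finset.card_erase_add_one h2
    have h4 : ((#{u : F | S u = 2 * (ε * M)} : ℕ) : ℤ) = 2 * M ^ 2 + ε * M := by
      apply mul_left_cancel₀ (mul_ne_zero four_ne_zero hεM)
      rw [hqM] at hpos
      linear_combination hpos - 4 * M ^ 2 * hε1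
    linarith
  · rw [card_filter_snd_eq_zero fun u => S u = -(2 * (ε * M))]
    apply mul_left_cancel₀ (mul_ne_zero four_ne_zero hεM)
    rw [hqM] at hneg
    linear_combination hneg + 4 * M ^ 2 * hε1
  · rintro ⟨u, v⟩ huv
    by_cases hv : v = 0
    · subst hv
      have hu : u ≠ 0 := fun hu => huv (by rw [hu])
      rcases hS u with h | h
      · exact Or.inr (Or.inl (hwt₂ u hu h))
      · exact Or.inr (Or.inr (hwt₃ u hu h))
    · exact Or.inl (hwt₁ u v hv)
end

section
/- Assume e/h is even, 2h < e, and write e = 2m. Let b = 0 and let a ∈ F_q^* be a (2^h+1)-th power in F_q^* (i.e., a = c^{2^h+1} for some c ∈ F_q^*). Then |D_{(a,0)}| = (q/2)·(q − (−1)^{m/h}·2^{m+h}) − 1, and among the q² − 1 pairs (u,v) ≠ (0,0), exactly q² − 2^{e−2h} pairs satisfy wt(c_{(u,v)}) = (q/4)·(q − (−1)^{m/h}·2^{m+h}), exactly 2^{e−2h−1} − (−1)^{m/h}·2^{m−h−1} − 1 pairs satisfy wt(c_{(u,v)}) = q²/4, and exactly 2^{e−2h−1} + (−1)^{m/h}·2^{m−h−1}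 pairs satisfy wt(c_{(u,v)}) = (q/4)·(q − (−1)^{m/h}·2^{m+h+1}); no other nonzero weights occur. -/
open Finset

/-- In a finite field of order `2 ^ e`, the absolute trace `∑ i < e, x ^ 2 ^ i` takes values in
`{0, 1}` and its sign is a primitive additive character invariant under squaring. -/
theorem exists_addChar_trace_sign {F : Type*} [Field F] [Fintype F] [DecidableEq F] {e : ℕ}
    (hF : Fintype.card F = 2 ^ e) :
    ∃ ψ : AddChar F ℤ, ψ.IsPrimitive ∧ (∀ x, ψ (x ^ 2) = ψ x) ∧
      (∀ x, (∑ i ∈ range e, x ^ 2 ^ i = 0 ∧ ψ x = 1) ∨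
        (∑ i ∈ range e, x ^ 2 ^ i = 1 ∧ ψ x = -1)) := by
  have : CharP F 2 := charP_of_card_eq_prime_pow hF
  let : Algebra (ZMod 2) F := ZMod.algebra F 2
  have hfin : Module.finrank (ZMod 2) F = e := by
    have h := Module.card_eq_pow_finrank (K := ZMod 2) (V := F)
    rw [hF, ZMod.card] at h
    exact (Nat.pow_right_injective le_rfl h).symm
  have htr (x : F) : algebraMap (ZMod 2) F (Algebra.trace (ZMod 2) F x) =
      ∑ i ∈ range e, x ^ 2 ^ i := by
    rw [FiniteField.algebraMap_trace_eq_sum_pow, hfin, Nat.card_zmod]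
  let ψ : AddChar F ℤ :=
    { toFun := fun x => if Algebra.trace (ZMod 2) F x = 0 then 1 else -1
      map_zero_eq_one' := by simp
      map_add_eq_mul' := fun x y => by
        have key : ∀ s t : ZMod 2, (if s + t = 0 then (1 : ℤ) else -1) =
          (if s = 0 then 1 else -1) * (if t = 0 then 1 else -1) := by decide
        rw [map_add]
        exact key _ _ }
  have hψ (x : F) : ψ x = if Algebra.trace (ZMod 2) F x = 0 then 1 else -1 := rfl
  refine ⟨ψ, AddChar.IsPrimitive.of_ne_one ?_, fun x => ?_, fun x => ?_⟩
  · obtain ⟨x, hx⟩ := Algebra.trace_surjective (ZMod 2) F 1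
    intro h
    have h1 : ψ x = 1 := by rw [h]; rfl
    rw [hψ, hx] at h1
    norm_num at h1
  · have hsq : Algebra.trace (ZMod 2) F (x ^ 2) = Algebra.trace (ZMod 2) F x := by
      have hid : ∀ s : ZMod 2, s ^ 2 = s := by decide
      apply (algebraMap (ZMod 2) F).injective
      rw [← hid (Algebra.trace (ZMod 2) F x), RingHom.map_pow, htr, htr, sum_pow_char]
      exact sum_congr rfl fun i _ => by rw [← pow_mul, ← pow_mul, mul_comm]
    rw [hψ, hψ, hsq]
  · have h01 : ∀ s : ZMod 2, s = 0 ∨ s = 1 := by decide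
    rw [← htr, hψ]
    rcases h01 (Algebra.trace (ZMod 2) F x) with h | h <;> simp [h]

/-- Over a field of characteristic two, `∑ i < 2 * m, w ^ 2 ^ i` vanishes at the fixed points of
the `h`-fold Frobenius whenever `h ∣ m`. -/
theorem sum_range_pow_two_pow_eq_zero {F : Type*} [Field F] [CharP F 2] {h m : ℕ} (hm : h ∣ m)
    {w : F} (hw : w ^ 2 ^ h = w) : ∑ i ∈ range (2 * m), w ^ 2 ^ i = 0 := by
  obtain ⟨k, rfl⟩ := hm
  have hk : w ^ 2 ^ (h * k) = w := by
    induction k with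
    | zero => simp
    | succ k ih => rw [mul_add_one, pow_add, pow_mul, ih, hw]
  rw [two_mul, sum_range_add, ← sum_add_distrib]
  refine sum_eq_zero fun i _ => ?_
  rw [pow_add, pow_mul, hk, CharTwo.add_self_eq_zero]

/-- If `n` divides the order of the unit group of a finite field, there are `n` solutions of
`x ^ n = 1`. -/
theorem card_units_pow_eq_one_s10 {F : Type*} [Field F] [Fintype F] [DecidableEq F] {n : ℕ}
    (hn : n ∣ Fintype.card F - 1) : #{x : Fˣ | x ^ n = 1} = n := by
  have h := IsCyclic.card_powMonoidHom_ker (G := Fˣ) n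
  rw [Nat.card_eq_fintype_card (α := Fˣ), Fintype.card_units, Nat.gcd_eq_right hn] at h
  rw [← Fintype.card_subtype, ← Nat.card_eq_fintype_card]
  exact h

/-- Splitting a sum over a finite field into the value at zero and the sum over the units. -/
theorem sum_eq_zero_add_sum_units_s10 {F M : Type*} [Field F] [Fintype F] [DecidableEq F]
    [AddCommMonoid M] (f : F → M) : ∑ x, f x = f 0 + ∑ x : Fˣ, f x := by
  rw [← add_sum_erase _ _ (mem_univ (0 : F))]
  congr 1
  refine (sum_bij (fun (x : Fˣ) _ => (x : F)) (by simp) (by simp [Units.ext_iff]) ?_ (by simp)).symm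
  intro b hb
  exact ⟨Units.mk0 b (ne_of_mem_erase hb), mem_univ _, rfl⟩

/-- A sum of a function of `x ^ n` over a finite field is its value at zero modulo `n`, when `n`
divides the order of the unit group. -/
theorem natCast_dvd_sum_pow_sub {F : Type*} [Field F] [Fintype F] [DecidableEq F] {n : ℕ}
    (hn0 : n ≠ 0) (hn : n ∣ Fintype.card F - 1) (f : F → ℤ) :
    (n : ℤ) ∣ ∑ x, f (x ^ n) - f 0 := by
  rw [sum_eq_zero_add_sum_units_s10, zero_pow hn0, add_sub_cancel_left]
  have h := sum_comp (s := univ) (fun y : Fˣ => f y) (powMonoidHom n : Fˣ →* Fˣ)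
  simp only [powMonoidHom_apply, Units.val_pow_eq_pow_val] at h
  rw [h]
  refine dvd_sum fun y hy => ?_
  rw [mem_image] at hy
  obtain ⟨x, -, rfl⟩ := hy
  have hc := MonoidHom.card_fiber_eq_of_mem_range (powMonoidHom n : Fˣ →* Fˣ)
    (x := x ^ n) (y := 1) ⟨x, rfl⟩ ⟨1, by simp⟩
  simp only [powMonoidHom_apply] at hc
  rw [card_units_pow_eq_one_s10 hn] at hc
  rw [powMonoidHom_apply, hc, nsmul_eq_mul]
  exact dvd_mul_right _ _

/-- The subfield `{z | z ^ (n + 1) = z}` has `n + 1` elements when `n` divides the order of the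
unit group. -/
theorem card_pow_succ_eq_self_s10 {F : Type*} [Field F] [Fintype F] [DecidableEq F] {n : ℕ}
    (hn : n ∣ Fintype.card F - 1) : #{z : F | z ^ (n + 1) = z} = n + 1 := by
  rw [card_filter, sum_eq_zero_add_sum_units_s10, if_pos (by simp), add_comm]
  congr 1
  rw [← card_filter]
  conv_rhs => rw [← card_units_pow_eq_one_s10 hn]
  congr 1
  ext x
  simp [pow_succ, Units.ext_iff]

/-- The exponential sum `∑ x, ψ (x ^ (2 ^ h + 1) + u * x)`. -/
def goldSum {F : Type*} [Field F] [Fintype F] (ψ : AddChar F ℤ) (h : ℕ) (u : F) : ℤ :=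
  ∑ x, ψ (x ^ (2 ^ h + 1) + u * x)

theorem AddChar.apply_pow_two_pow {F : Type*} [Field F] {ψ : AddChar F ℤ}
    (hsq : ∀ x, ψ (x ^ 2) = ψ x) (k : ℕ) (x : F) :
    ψ (x ^ 2 ^ k) = ψ x := by
  induction k with
  | zero => simp
  | succ k ih => rw [pow_succ, pow_mul, hsq, ih]

theorem AddChar.apply_mul_self_of_charTwo {F : Type*} [Field F] [CharP F 2] (ψ : AddChar F ℤ)
    (x : F) : ψ x * ψ x = 1 := by
  rw [← ψ.map_add_eq_mul, CharTwo.add_self_eq_zero, ψ.map_zero_eq_one]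

section GoldSum

variable {F : Type*} [Field F] [Fintype F] {ψ : AddChar F ℤ} {h : ℕ}

/-- The square of `goldSum` as a sum over the radical of the associated bilinear form. -/
theorem goldSum_sq [DecidableEq F] [CharP F 2] (hψ : ψ.IsPrimitive)
    (hsq : ∀ x, ψ (x ^ 2) = ψ x) (u : F) :
    goldSum ψ h u ^ 2 = Fintype.card F *
      ∑ z with z ^ 2 ^ (2 * h) = z, ψ (z ^ (2 ^ h + 1) + u * z) := by
  have hbil (z : F) : ∑ x, ψ (x ^ 2 ^ h * z + x * z ^ 2 ^ h) =
      if z ^ 2 ^ (2 * h) = z then (Fintype.card F : ℤ) else 0 := by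
    have hshift (x : F) : ψ (x ^ 2 ^ h * z + x * z ^ 2 ^ h) =
        ψ (iterateFrobenius F 2 h x * (z + z ^ 2 ^ (2 * h))) := by
      rw [iterateFrobenius_def, mul_add, ψ.map_add_eq_mul, ψ.map_add_eq_mul,
        ← AddChar.apply_pow_two_pow hsq h (x * z ^ 2 ^ h), mul_pow, ← pow_mul, ← pow_add, two_mul]
    rw [sum_congr rfl fun x _ => hshift x,
      (Finite.injective_iff_bijective.mp (iterateFrobenius F 2 h).injective).sum_comp
        (fun y => ψ (y * (z + z ^ 2 ^ (2 * h)))), AddChar.sum_mulShift _ hψ]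
    have hz : z + z ^ 2 ^ (2 * h) = 0 ↔ z ^ 2 ^ (2 * h) = z := by
      rw [CharTwo.add_eq_zero, eq_comm]
    simp only [hz, Nat.cast_ite, Nat.cast_zero]
  have hpair (x z : F) : ψ (x ^ (2 ^ h + 1) + u * x) *
      ψ ((x + z) ^ (2 ^ h + 1) + u * (x + z)) =
      ψ (z ^ (2 ^ h + 1) + u * z) * ψ (x ^ 2 ^ h * z + x * z ^ 2 ^ h) := by
    have hexp : (x + z) ^ (2 ^ h + 1) + u * (x + z) = (x ^ (2 ^ h + 1) + u * x) +
        ((z ^ (2 ^ h + 1) + u * z) + (x ^ 2 ^ h * z + x * z ^ 2 ^ h)) := by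
      rw [pow_succ, add_pow_char_pow]
      ring
    rw [hexp, ψ.map_add_eq_mul (x ^ (2 ^ h + 1) + u * x), ← mul_assoc,
      AddChar.apply_mul_self_of_charTwo, one_mul, ψ.map_add_eq_mul]
  calc goldSum ψ h u ^ 2
      = ∑ x, ∑ z, ψ (x ^ (2 ^ h + 1) + u * x) *
          ψ ((x + z) ^ (2 ^ h + 1) + u * (x + z)) := by
        rw [sq]
        nth_rewrite 1 [goldSum]
        rw [sum_mul]
        refine sum_congr rfl fun x _ => ?_
        rw [← mul_sum]
        congr 1
        exact (Equiv.sum_comp (Equiv.addLeft x) (fun y => ψ (y ^ (2 ^ h + 1) + u * y))).symm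
    _ = ∑ z, ψ (z ^ (2 ^ h + 1) + u * z) * ∑ x, ψ (x ^ 2 ^ h * z + x * z ^ 2 ^ h) := by
        rw [sum_comm]
        simp only [hpair, mul_sum]
    _ = _ := by
        simp only [hbil, mul_ite, mul_zero]
        rw [← sum_filter, mul_sum]
        exact sum_congr rfl fun z _ => mul_comm _ _

theorem sum_goldSum [DecidableEq F] (hψ : ψ.IsPrimitive) :
    ∑ u, goldSum ψ h u = Fintype.card F := by
  simp only [goldSum, ψ.map_add_eq_mul]
  rw [sum_comm]
  simp only [← mul_sum, AddChar.sum_mulShift _ hψ]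
  simp

theorem sum_goldSum_sq [DecidableEq F] [CharP F 2] (hψ : ψ.IsPrimitive)
    (hsq : ∀ x, ψ (x ^ 2) = ψ x) :
    ∑ u, goldSum ψ h u ^ 2 = (Fintype.card F : ℤ) ^ 2 := by
  simp only [goldSum_sq hψ hsq, ψ.map_add_eq_mul]
  rw [← mul_sum, sum_comm]
  simp only [← mul_sum, AddChar.sum_mulShift _ hψ]
  simp [sq]

/-- When `ψ (z ^ (2 ^ h + 1)) = 1` on the radical, every value of `goldSum` is zero or has the
same square. -/
theorem goldSum_sq_eq_zero_or [DecidableEq F] [CharP F 2] (hψ : ψ.IsPrimitive)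
    (hsq : ∀ x, ψ (x ^ 2) = ψ x)
    (hrad : ∀ z : F, z ^ 2 ^ (2 * h) = z → ψ (z ^ (2 ^ h + 1)) = 1) (u : F) :
    goldSum ψ h u ^ 2 = 0 ∨
      goldSum ψ h u ^ 2 = Fintype.card F * #{z : F | z ^ 2 ^ (2 * h) = z} := by
  have hsum : ∑ z with z ^ 2 ^ (2 * h) = z, ψ (z ^ (2 ^ h + 1) + u * z) =
      ∑ z : F with z ^ 2 ^ (2 * h) = z, ψ (u * z) :=
    sum_congr rfl fun z hz => by
      rw [ψ.map_add_eq_mul, hrad z (mem_filter.mp hz).2, one_mul]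
  rw [goldSum_sq hψ hsq, hsum]
  by_cases hu : ∀ z : F, z ^ 2 ^ (2 * h) = z → ψ (u * z) = 1
  · right
    rw [sum_congr rfl fun z hz => hu z (mem_filter.mp hz).2]
    simp
  · left
    push Not at hu
    obtain ⟨y, hy, hy1⟩ := hu
    have hshift : ∑ z : F with z ^ 2 ^ (2 * h) = z, ψ (u * z) =
        ψ (u * y) * ∑ z : F with z ^ 2 ^ (2 * h) = z, ψ (u * z) := by
      rw [mul_sum]
      refine (sum_equiv (Equiv.addLeft y) (fun z => ?_) fun z _ => ?_).symm
      · simp [add_pow_char_pow, hy]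
      · rw [Equiv.coe_addLeft, mul_add, ψ.map_add_eq_mul]
    have h0 : (1 - ψ (u * y)) * ∑ z : F with z ^ 2 ^ (2 * h) = z, ψ (u * z) = 0 := by
      rw [sub_mul, ← hshift, one_mul, sub_self]
    rw [(mul_eq_zero.mp h0).resolve_left (sub_ne_zero.mpr (Ne.symm hy1)), mul_zero]

theorem goldSum_zero_sq [DecidableEq F] [CharP F 2] (hψ : ψ.IsPrimitive)
    (hsq : ∀ x, ψ (x ^ 2) = ψ x)
    (hrad : ∀ z : F, z ^ 2 ^ (2 * h) = z → ψ (z ^ (2 ^ h + 1)) = 1) :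
    goldSum ψ h 0 ^ 2 = Fintype.card F * #{z : F | z ^ 2 ^ (2 * h) = z} := by
  rw [goldSum_sq hψ hsq,
    sum_congr rfl fun z hz => by rw [zero_mul, add_zero, hrad z (mem_filter.mp hz).2]]
  simp

/-- `goldSum` at zero is determined, sign included, by its square and its residue modulo
`2 ^ h + 1`. -/
theorem goldSum_zero [DecidableEq F] [CharP F 2] (hψ : ψ.IsPrimitive)
    (hsq : ∀ x, ψ (x ^ 2) = ψ x) {k : ℕ} (hh : h ≠ 0)
    (hF : Fintype.card F = 2 ^ (2 * (h * k)))
    (hrad : ∀ z : F, z ^ 2 ^ (2 * h) = z → ψ (z ^ (2 ^ h + 1)) = 1) :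
    goldSum ψ h 0 = -((-1) ^ k * 2 ^ (h * k + h)) := by
  have hdvd : 2 ^ (2 * h) - 1 ∣ Fintype.card F - 1 := by
    rw [hF, ← mul_assoc, pow_mul 2 (2 * h)]
    have := Nat.sub_dvd_pow_sub_pow (2 ^ (2 * h)) 1 k
    rwa [one_pow] at this
  have hpos : 1 ≤ 2 ^ (2 * h) := Nat.one_le_two_pow
  have hn : 2 ^ h + 1 ∣ Fintype.card F - 1 := by
    refine dvd_trans ⟨2 ^ h - 1, ?_⟩ hdvd
    rw [mul_comm 2 h, pow_mul, ← Nat.sq_sub_sq, one_pow]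
  have hcard := card_pow_succ_eq_self_s10 hdvd
  rw [Nat.sub_add_cancel hpos] at hcard
  have h2 : goldSum ψ h 0 ^ 2 = (2 ^ (h * k + h)) ^ 2 := by
    rw [goldSum_zero_sq hψ hsq hrad, hcard, hF]
    push_cast
    ring
  have hmod : ((2 ^ h + 1 : ℕ) : ℤ) ∣ goldSum ψ h 0 - 1 := by
    have := natCast_dvd_sum_pow_sub (Nat.succ_ne_zero (2 ^ h)) hn (fun y => ψ y)
    simpa [goldSum] using this
  have hpow : ((2 ^ h + 1 : ℕ) : ℤ) ∣ 2 ^ (h * k + h) - (-1) ^ (k + 1) := by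
    have := sub_dvd_pow_sub_pow ((2 : ℤ) ^ h) (-1) (k + 1)
    rw [← pow_mul, mul_add_one, sub_neg_eq_add] at this
    exact_mod_cast this
  have hge : (2 : ℤ) ≤ 2 ^ h := le_self_pow₀ one_le_two hh
  have hndvd : ¬ ((2 ^ h + 1 : ℕ) : ℤ) ∣ 2 := fun hd => by
    have := Int.le_of_dvd two_pos hd
    push_cast at this
    linarith
  rcases neg_one_pow_eq_or ℤ k with hk | hk <;> rw [pow_succ, hk] at hpow <;> rw [hk] <;>
    rcases sq_eq_sq_iff_eq_or_eq_neg.mp h2 with hS | hS <;> rw [hS] at hmod ⊢ <;>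
    first
    | (ring; done)
    | (obtain ⟨a, ha⟩ := hmod
       obtain ⟨b, hb⟩ := hpow
       refine absurd ?_ hndvd
       first
       | exact ⟨b - a, by linarith⟩
       | exact ⟨-a - b, by linarith⟩)

end GoldSum

/-- Character sum count of the simultaneous conditions `ψ (f p) = 1` and `ψ (g p) = -1`. -/
theorem four_mul_card_filter {F ι : Type*} [AddGroup F] [Fintype ι] {ψ : AddChar F ℤ}
    (hsign : ∀ x, ψ x = 1 ∨ ψ x = -1) (f g : ι → F) :
    4 * (#{p | ψ (f p) = 1 ∧ ψ (g p) = -1} : ℤ) =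
      ∑ p, (1 + ψ (f p) - ψ (g p) - ψ (f p + g p)) := by
  rw [card_filter, Nat.cast_sum, mul_sum]
  refine sum_congr rfl fun p _ => ?_
  rw [ψ.map_add_eq_mul]
  rcases hsign (f p) with hf | hf <;> rcases hsign (g p) with hg | hg <;> rw [hf, hg] <;> norm_num

theorem two_mul_card_filter {F ι : Type*} [AddGroup F] [Fintype ι] {ψ : AddChar F ℤ}
    (hsign : ∀ x, ψ x = 1 ∨ ψ x = -1) (f : ι → F) :
    2 * (#{p | ψ (f p) = 1} : ℤ) = ∑ p, (1 + ψ (f p)) := by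
  rw [card_filter, Nat.cast_sum, mul_sum]
  refine sum_congr rfl fun p _ => ?_
  rcases hsign (f p) with hf | hf <;> rw [hf] <;> norm_num

/-- An integer function with values in `{0, t, -t}` has its value distribution determined by its
first two moments. -/
theorem card_eq_of_moments {ι : Type*} [Fintype ι] [DecidableEq ι] {T : ι → ℤ} {t M N : ℤ}
    (ht : t ≠ 0) (hT : ∀ u, T u = 0 ∨ T u = t ∨ T u = -t)
    (h1 : ∑ u, T u = (M - N) * t) (h2 : ∑ u, T u ^ 2 = (M + N) * t ^ 2) :
    (#{u | T u = t} : ℤ) = M ∧ (#{u | T u = -t} : ℤ) = N := by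
  have hne : t ≠ -t := fun h => ht (by linarith)
  have hT1 (u : ι) : T u = ((if T u = t then 1 else 0) - (if T u = -t then 1 else 0)) * t := by
    rcases hT u with h | h | h <;> rw [h] <;> simp [ht, hne, hne.symm, eq_comm]
  have hT2 (u : ι) :
      T u ^ 2 = ((if T u = t then 1 else 0) + (if T u = -t then 1 else 0)) * t ^ 2 := by
    rcases hT u with h | h | h <;> rw [h] <;> simp [ht, hne, hne.symm, eq_comm]
  rw [sum_congr rfl fun u _ => hT1 u, ← sum_mul, sum_sub_distrib, sum_boole, sum_boole] at h1
  rw [sum_congr rfl fun u _ => hT2 u, ← sum_mul, sum_add_distrib, sum_boole, sum_boole] at h2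
  have e1 := mul_right_cancel₀ ht h1
  have e2 := mul_right_cancel₀ (pow_ne_zero 2 ht) h2
  constructor <;> linarith

/-- The value distribution, away from the origin, of a function on `F × F` supported on the first
axis, in terms of that of its restriction `T` to the axis. -/
theorem card_pairs_of_card {F : Type*} [Zero F] [Fintype F] [DecidableEq F] {T : F → ℤ}
    {t M N : ℤ} (ht : t ≠ 0) (hT : ∀ u, T u = 0 ∨ T u = t ∨ T u = -t) (hT0 : T 0 = t)
    (hM : (#{u | T u = t} : ℤ) = M) (hN : (#{u | T u = -t} : ℤ) = N) :
    (#{p : F × F | p ≠ (0, 0) ∧ (if p.2 = 0 then T p.1 else 0) = 0} : ℤ) =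
      (Fintype.card F : ℤ) ^ 2 - (M + N) ∧
    (#{p : F × F | p ≠ (0, 0) ∧ (if p.2 = 0 then T p.1 else 0) = t} : ℤ) = M - 1 ∧
    (#{p : F × F | p ≠ (0, 0) ∧ (if p.2 = 0 then T p.1 else 0) = -t} : ℤ) = N := by
  have hne : t ≠ -t := fun h => ht (by linarith)
  have hcount (s : ℤ) (hs : s ≠ 0) :
      #{p : F × F | (if p.2 = 0 then T p.1 else 0) = s} = #{u | T u = s} := by
    refine (card_bij (fun u _ => (u, 0)) (by simp) (by simp) ?_).symm
    rintro ⟨u, v⟩ huv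
    simp only [mem_filter, mem_univ, true_and] at huv
    split_ifs at huv with hv
    · exact ⟨u, by simpa using huv, by rw [hv]⟩
    · exact absurd huv.symm hs
  have hpos : (#{p : F × F | p ≠ (0, 0) ∧ (if p.2 = 0 then T p.1 else 0) = t} : ℤ) = M - 1 := by
    have he : ({p : F × F | p ≠ (0, 0) ∧ (if p.2 = 0 then T p.1 else 0) = t} : Finset _) =
        ({p : F × F | (if p.2 = 0 then T p.1 else 0) = t} : Finset _).erase (0, 0) := by
      ext p
      simp only [mem_filter, mem_univ, true_and, mem_erase]
    have hmem : ((0, 0) : F × F) ∈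
        ({p : F × F | (if p.2 = 0 then T p.1 else 0) = t} : Finset _) := by simp [hT0]
    rw [← hM, ← hcount t ht, ← card_erase_add_one hmem, he]
    push_cast
    ring
  have hneg : (#{p : F × F | p ≠ (0, 0) ∧ (if p.2 = 0 then T p.1 else 0) = -t} : ℤ) = N := by
    rw [← hN, ← hcount (-t) (neg_ne_zero.mpr ht)]
    congr 2
    ext p
    simp only [mem_filter, mem_univ, true_and, and_iff_right_iff_imp]
    rintro hp rfl
    simp [hT0, hne] at hp
  refine ⟨?_, hpos, hneg⟩
  have htotal : ∑ p : F × F, (1 : ℤ) = ∑ p : F × F,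
      ((if p = (0, 0) then 1 else 0) +
        (if p ≠ (0, 0) ∧ (if p.2 = 0 then T p.1 else 0) = 0 then 1 else 0) +
        (if p ≠ (0, 0) ∧ (if p.2 = 0 then T p.1 else 0) = t then 1 else 0) +
        (if p ≠ (0, 0) ∧ (if p.2 = 0 then T p.1 else 0) = -t then 1 else 0)) := by
    refine sum_congr rfl fun p _ => ?_
    have hG : (if p.2 = 0 then T p.1 else 0) = 0 ∨ (if p.2 = 0 then T p.1 else 0) = t ∨
        (if p.2 = 0 then T p.1 else 0) = -t := by
      split_ifs
      · exact hT _
      · exact Or.inl rfl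
    generalize (if p.2 = 0 then T p.1 else 0) = g at hG
    by_cases hp : p = (0, 0)
    · simp [hp]
    · rcases hG with rfl | rfl | rfl <;> simp [hp, ht, ht.symm, hne, hne.symm]
  rw [sum_add_distrib, sum_add_distrib, sum_add_distrib, sum_boole, sum_boole, sum_boole,
    sum_boole, hpos, hneg] at htotal
  have hsq : ∑ p : F × F, (1 : ℤ) = (Fintype.card F : ℤ) ^ 2 := by simp [sq]
  have h1 : (#{p : F × F | p = (0, 0)} : ℤ) = 1 := by simp [filter_eq']
  rw [hsq, h1] at htotal
  linarith

/-- Theorem 2(ii): `e/h` even, `2h < e`, `e = 2m`, `b = 0`, `a` a `(2^h+1)`-th power. Then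
`|D_{(a,0)}| = (q/2)(q − (−1)^{m/h} 2^{m+h}) − 1` and the weight distribution is:
`q² − 2^{e−2h}` codewords of weight `(q/4)(q − (−1)^{m/h} 2^{m+h})`,
`2^{e−2h−1} − (−1)^{m/h} 2^{m−h−1} − 1` of weight `q²/4`, and
`2^{e−2h−1} + (−1)^{m/h} 2^{m−h−1}` of weight `(q/4)(q − (−1)^{m/h} 2^{m+h+1})`;
no other nonzero weights occur. -/
theorem stmt_10
    (e h m : ℕ) (hdvd : h ∣ e) (hh0 : 0 < h) (hhe : h < e) (h2h : 2 * h < e)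
    (heven : Even (e / h)) (hm : e = 2 * m)
    (F : Type) [Field F] [Fintype F] [DecidableEq F]
    (hF : Fintype.card F = 2 ^ e)
    (q : ℤ) (hq : q = 2 ^ e)
    (Tr : F → F) (hTr : ∀ x, Tr x = ∑ i ∈ Finset.range e, x ^ 2 ^ i)
    (a : F) (ha : a ≠ 0)
    (c : F) (hc : c ≠ 0) (hac : a = c ^ (2 ^ h + 1))
    (D : Finset (F × F))
    (hD : D = Finset.univ.filter fun p : F × F =>
        p ≠ (0, 0) ∧ Tr (a * p.1 ^ (2 ^ h + 1)) = 0)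
    (wt : F × F → ℕ)
    (hwt : ∀ u v : F, wt (u, v) =
        (D.filter fun p => Tr (u * p.1 + v * p.2) = 1).card) :
    ((D.card : ℤ) = q / 2 * (q - (-1 : ℤ) ^ (m / h) * 2 ^ (m + h)) - 1) ∧
    (((Finset.univ.filter fun uv : F × F =>
        uv ≠ (0, 0) ∧ (wt uv : ℤ) = q / 4 * (q - (-1 : ℤ) ^ (m / h) * 2 ^ (m + h))).card : ℤ)
      = q ^ 2 - 2 ^ (e - 2 * h)) ∧
    (((Finset.univ.filter fun uv : F × F =>
        uv ≠ (0, 0) ∧ (wt uv : ℤ) = q ^ 2 / 4).card : ℤ)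
      = 2 ^ (e - 2 * h - 1) - (-1 : ℤ) ^ (m / h) * 2 ^ (m - h - 1) - 1) ∧
    (((Finset.univ.filter fun uv : F × F =>
        uv ≠ (0, 0) ∧
          (wt uv : ℤ) = q / 4 * (q - (-1 : ℤ) ^ (m / h) * 2 ^ (m + h + 1))).card : ℤ)
      = 2 ^ (e - 2 * h - 1) + (-1 : ℤ) ^ (m / h) * 2 ^ (m - h - 1)) ∧
    (∀ uv : F × F, uv ≠ (0, 0) →
      (wt uv : ℤ) = q / 4 * (q - (-1 : ℤ) ^ (m / h) * 2 ^ (m + h)) ∨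
      (wt uv : ℤ) = q ^ 2 / 4 ∨
      (wt uv : ℤ) = q / 4 * (q - (-1 : ℤ) ^ (m / h) * 2 ^ (m + h + 1))) := by
  classical
  obtain ⟨ψ, hψ, hsq, hval⟩ := exists_addChar_trace_sign hF
  have : CharP F 2 := charP_of_card_eq_prime_pow hF
  obtain ⟨k, hk⟩ : ∃ k, m = h * k := by
    obtain ⟨d, rfl⟩ := hdvd
    rw [Nat.mul_div_cancel_left _ hh0] at heven
    obtain ⟨k, rfl⟩ := heven
    exact ⟨k, by linarith⟩
  have hmk : m / h = k := by rw [hk, Nat.mul_div_cancel_left _ hh0]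
  have hk2 : 2 ≤ k := by
    by_contra hlt
    have : k ≤ 1 := by omega
    have : h * k ≤ h * 1 := Nat.mul_le_mul_left h this
    omega
  have hm2h : 2 * h ≤ m := by
    rw [hk, mul_comm 2 h]
    exact Nat.mul_le_mul_left h hk2
  have hTr0 (x : F) : Tr x = 0 ↔ ψ x = 1 := by
    rw [hTr]
    rcases hval x with ⟨h1, h2⟩ | ⟨h1, h2⟩ <;> rw [h1, h2] <;> norm_num
  have hTr1 (x : F) : Tr x = 1 ↔ ψ x = -1 := by
    rw [hTr]
    rcases hval x with ⟨h1, h2⟩ | ⟨h1, h2⟩ <;> rw [h1, h2] <;> norm_num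
  have hsign (x : F) : ψ x = 1 ∨ ψ x = -1 := (hval x).imp And.right And.right
  have hqF : (Fintype.card F : ℤ) = q := by rw [hF, hq]; norm_num
  have hrad (z : F) (hz : z ^ 2 ^ (2 * h) = z) : ψ (z ^ (2 ^ h + 1)) = 1 := by
    rw [← hTr0, hTr, hm]
    refine sum_range_pow_two_pow_eq_zero ⟨k, hk⟩ ?_
    rw [← pow_mul, add_one_mul, ← pow_add, ← two_mul, pow_add, hz, pow_succ, mul_comm]
  obtain ⟨s, hs⟩ : ∃ s : ℤ, s = (-1) ^ k := ⟨_, rfl⟩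
  obtain ⟨P, hP⟩ : ∃ P : ℤ, P = 2 ^ (m + h) := ⟨_, rfl⟩
  obtain ⟨w, hw⟩ : ∃ w : ℤ, w = 2 ^ (m - h - 1) := ⟨_, rfl⟩
  obtain ⟨r, hr⟩ : ∃ r : ℤ, r = 2 ^ (e - 2) := ⟨_, rfl⟩
  have hs2 : s * s = 1 := by rw [hs, ← mul_pow]; norm_num
  have hP0 : P ≠ 0 := by rw [hP]; positivity
  have hr0 : r ≠ 0 := by rw [hr]; positivity
  have hqr : q = 4 * r := by
    rw [hq, hr, show (4 : ℤ) = 2 ^ 2 by norm_num, ← pow_add]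
    congr 1; omega
  have hPw : q = 2 * P * w := by
    rw [hq, hP, hw, ← pow_succ', ← pow_add]
    congr 1; omega
  have hw1 : (2 : ℤ) ^ (e - 2 * h - 1) = 2 * w ^ 2 := by
    rw [hw, ← pow_mul, ← pow_succ']
    congr 1; omega
  have hw2 : (2 : ℤ) ^ (e - 2 * h) = 4 * w ^ 2 := by
    rw [show e - 2 * h = (e - 2 * h - 1) + 1 by omega, pow_succ, hw1]
    ring
  obtain ⟨T, hTdef⟩ : ∃ T : F → ℤ, T = fun u => goldSum ψ h (u / c) := ⟨_, rfl⟩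
  have hTsum (u : F) : ∑ x, ψ (a * x ^ (2 ^ h + 1) + u * x) = T u := by
    have h1 := Equiv.sum_comp (Equiv.mulLeft₀ c hc)
      (fun x => ψ (x ^ (2 ^ h + 1) + u / c * x))
    simp only [hTdef, goldSum]
    rw [← h1]
    refine sum_congr rfl fun x _ => ?_
    rw [Equiv.mulLeft₀_apply, hac, mul_pow, ← mul_assoc (u / c), div_mul_cancel₀ _ hc]
  have hT0sum : ∑ x, ψ (a * x ^ (2 ^ h + 1)) = T 0 := by
    rw [← hTsum]
    simp only [zero_mul, add_zero]
  have hT0 : T 0 = -(s * P) := by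
    rw [hTdef, hs, hP, hk]
    simp only [zero_div]
    exact goldSum_zero hψ hsq hh0.ne' (by rw [hF, hm, hk]) hrad
  have ht0 : -(s * P) ≠ 0 :=
    neg_ne_zero.mpr (mul_ne_zero (by rintro rfl; norm_num at hs2) hP0)
  have hTvals (u : F) : T u = 0 ∨ T u = -(s * P) ∨ T u = -(-(s * P)) := by
    have h0 := goldSum_zero_sq hψ hsq hrad
    have hT0' : T 0 = goldSum ψ h 0 := by rw [hTdef]; simp
    rcases goldSum_sq_eq_zero_or hψ hsq hrad (u / c) with hu | hu
    · left
      rw [hTdef]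
      exact pow_eq_zero_iff two_ne_zero |>.mp hu
    · right
      rw [← h0, ← hT0', hT0] at hu
      rw [hTdef]
      exact sq_eq_sq_iff_eq_or_eq_neg.mp hu
  have hmom1 : ∑ u, T u = ((2 * w ^ 2 - s * w) - (2 * w ^ 2 + s * w)) * -(s * P) := by
    have h1 := Equiv.sum_comp (Equiv.divRight₀ c hc) (goldSum ψ h)
    simp only [Equiv.divRight₀_apply] at h1
    rw [hTdef, h1, sum_goldSum hψ, hqF, hPw]
    linear_combination -2 * w * P * hs2
  have hmom2 : ∑ u, T u ^ 2 =
      ((2 * w ^ 2 - s * w) + (2 * w ^ 2 + s * w)) * (-(s * P)) ^ 2 := by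
    have h1 := Equiv.sum_comp (Equiv.divRight₀ c hc) (fun u => goldSum ψ h u ^ 2)
    simp only [Equiv.divRight₀_apply] at h1
    rw [hTdef, h1, sum_goldSum_sq hψ hsq, hqF, hPw]
    linear_combination -4 * w ^ 2 * P ^ 2 * hs2
  obtain ⟨hM, hN⟩ := card_eq_of_moments ht0 hTvals hmom1 hmom2
  obtain ⟨hc0, hc1, hc2⟩ := card_pairs_of_card ht0 hTvals hT0 hM hN
  have hf : ∑ p : F × F, ψ (a * p.1 ^ (2 ^ h + 1)) = q * T 0 := by
    rw [Fintype.sum_prod_type, ← hT0sum, mul_sum]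
    simp [hqF]
  have hone : ∑ p : F × F, (1 : ℤ) = q ^ 2 := by simp [sq, hqF]
  have hDcard : (#D : ℤ) + 1 = #{p : F × F | ψ (a * p.1 ^ (2 ^ h + 1)) = 1} := by
    have hmem : ((0, 0) : F × F) ∈
        ({p : F × F | ψ (a * p.1 ^ (2 ^ h + 1)) = 1} : Finset _) := by simp
    rw [← card_erase_add_one hmem, hD]
    push_cast
    congr 3
    ext p
    simp only [mem_filter, mem_univ, true_and, mem_erase, hTr0]
  have hwtq (u v : F) (huv : (u, v) ≠ (0, 0)) :
      (wt (u, v) : ℤ) = r * (q - s * P - if v = 0 then T u else 0) := by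
    have hset : D.filter (fun p => Tr (u * p.1 + v * p.2) = 1) =
        ({p : F × F | ψ (a * p.1 ^ (2 ^ h + 1)) = 1 ∧ ψ (u * p.1 + v * p.2) = -1} :
          Finset _) := by
      ext p
      simp only [hD, mem_filter, mem_univ, true_and, hTr0, hTr1]
      refine ⟨fun hp => ⟨hp.1.2, hp.2⟩, fun hp => ⟨⟨?_, hp.1⟩, hp.2⟩⟩
      rintro rfl
      norm_num at hp
    have hg : ∑ p : F × F, ψ (u * p.1 + v * p.2) = 0 := by
      rw [Fintype.sum_prod_type]
      simp only [ψ.map_add_eq_mul]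
      rw [← Fintype.sum_mul_sum]
      simp only [mul_comm u, mul_comm v, AddChar.sum_mulShift _ hψ]
      by_cases hu : u = 0
      · have hv : v ≠ 0 := fun hv => huv (by rw [hu, hv])
        simp [hv]
      · simp [hu]
    have hfg : ∑ p : F × F, ψ (a * p.1 ^ (2 ^ h + 1) + (u * p.1 + v * p.2)) =
        q * if v = 0 then T u else 0 := by
      rw [Fintype.sum_prod_type]
      simp only [← add_assoc]
      simp only [ψ.map_add_eq_mul _ (v * _)]
      rw [← Fintype.sum_mul_sum, hTsum]
      simp only [mul_comm v, AddChar.sum_mulShift _ hψ]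
      split_ifs <;> simp [hqF, mul_comm]
    have h4 := four_mul_card_filter hsign (fun p : F × F => a * p.1 ^ (2 ^ h + 1))
      (fun p => u * p.1 + v * p.2)
    rw [sum_sub_distrib, sum_sub_distrib, sum_add_distrib, hone, hf, hg, hfg, hT0, ← hset,
      ← hwt] at h4
    generalize (if v = 0 then T u else 0) = g at h4 ⊢
    rw [hqr] at h4 ⊢
    linarith
  have hq2 : q / 2 = 2 * r := by omega
  have hq4 : q / 4 = r := by omega
  have hqq : q ^ 2 / 4 = r * q := by
    rw [show q ^ 2 = 4 * (r * q) by rw [hqr]; ring]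
    exact Int.mul_ediv_cancel_left _ (by norm_num)
  have hP2 : (2 : ℤ) ^ (m + h + 1) = 2 * P := by rw [pow_succ', hP]
  rw [hmk, ← hs, hP2, ← hP, ← hw, hw1, hw2, hqq, hq2, hq4]
  have hw0 (p : F × F) (hp : p ≠ (0, 0)) :
      (wt p : ℤ) = r * (q - s * P) ↔ (if p.2 = 0 then T p.1 else 0) = 0 := by
    rw [hwtq p.1 p.2 hp, mul_right_inj' hr0]
    constructor <;> intro h <;> linarith
  have hwpos (p : F × F) (hp : p ≠ (0, 0)) :
      (wt p : ℤ) = r * q ↔ (if p.2 = 0 then T p.1 else 0) = -(s * P) := by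
    rw [hwtq p.1 p.2 hp, mul_right_inj' hr0]
    constructor <;> intro h <;> linarith
  have hwneg (p : F × F) (hp : p ≠ (0, 0)) :
      (wt p : ℤ) = r * (q - s * (2 * P)) ↔
        (if p.2 = 0 then T p.1 else 0) = -(-(s * P)) := by
    rw [hwtq p.1 p.2 hp, mul_right_inj' hr0]
    constructor <;> intro h <;> linarith
  refine ⟨?_, ?_, ?_, ?_, fun p hp => ?_⟩
  · have h2 := two_mul_card_filter hsign (fun p : F × F => a * p.1 ^ (2 ^ h + 1))
    rw [sum_add_distrib, hone, hf, hT0, ← hDcard] at h2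
    rw [hqr] at h2 ⊢
    linarith
  · rw [filter_congr fun p _ => and_congr_right (hw0 p), hc0, hqF]
    ring
  · rw [filter_congr fun p _ => and_congr_right (hwpos p), hc1]
  · rw [filter_congr fun p _ => and_congr_right (hwneg p), hc2]
  · rw [hw0 p hp, hwpos p hp, hwneg p hp]
    split_ifs
    · exact hTvals p.1
    · exact Or.inl rfl
end
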